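/- arXiv:2603.23928 — 4 statements merged into one kernel-verified Lean document; each statement's English description precedes it below -/
import Mathlib

section
/- Let η ∈ (0, 1/6) and θ ∈ (0, 1). Then as n → ∞ along integers n satisfying P⁺(n) ≥ n^θ, the proportion of pairs (p,q) ∈ H_n(η) satisfying gcd(q, P⁺(n)) = 1 and S(p,q) < 5 tends to 0; that is, for every ε > 0 there exists N such that for all n ≥ N with P⁺(n) ≥ n^θ, the number of (p,q) ∈ H_n(η) with gcd(q, P⁺(n)) = 1 and S(p,q) < 5 is at most ε · |H_n(η)|. -/
open Finset
open scoped Classical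

/-- `U n` : the reduced residue system `{a ∈ {1,…,n} : gcd(a,n) = 1}`. -/
def Un (n : ℕ) : Finset ℕ := (Finset.Icc 1 n).filter (fun a => Nat.gcd a n = 1)

/-- Indicator `1_{I_m}(x)`: equals `1` if `1 ≤ [x]_n ≤ m`, else `0`. -/
def ind (n m x : ℕ) : ℕ := if 1 ≤ x % n ∧ x % n ≤ m then 1 else 0

/-- `S(p,q) = Σ_{a ∈ U_n} 1_{I_{2p−1}}(ap) · 1_{I_{2q−1}}(aq)`. -/
def Sfun (n p q : ℕ) : ℕ := ∑ a ∈ Un n, ind n (2 * p - 1) (a * p) * ind n (2 * q - 1) (a * q)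

/-- `P⁺(n)` : the largest prime factor of `n`. -/
def Pplus (n : ℕ) : ℕ := n.primeFactors.sup id

/-- `H_n(η) = {(p,q) ∈ ℤ²_{≥1} : min(p,q) > ηn, p + q < n/2, gcd(p,q,n) = 1}`. -/
noncomputable def Hwin (n : ℕ) (η : ℝ) : Finset (ℕ × ℕ) :=
  ((Finset.Icc 1 n) ×ˢ (Finset.Icc 1 n)).filter
    (fun pq => η * n < (min pq.1 pq.2 : ℕ) ∧ 2 * (pq.1 + pq.2) < n ∧
      Nat.gcd (Nat.gcd pq.1 pq.2) n = 1)


/-- Two residues in the same box of side `r / M` differ by less than `r / M`. -/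
lemma box_close (r M x y : ℕ) (hr : 0 < r) (h : M * x / r = M * y / r) :
    M * |(x : ℤ) - y| < r := by
  have h1 := Nat.div_add_mod (M * x) r
  have h2 := Nat.div_add_mod (M * y) r
  have h3 := Nat.mod_lt (M * x) hr
  have h4 := Nat.mod_lt (M * y) hr
  rw [h] at h1
  have hM : (M : ℤ) * |(x : ℤ) - y| = |(M * x : ℤ) - M * y| := by
    rw [← mul_sub, abs_mul, Nat.abs_cast]
  rw [hM, abs_lt]
  zify at h1 h2 h3 h4
  constructor <;> linarith [Int.natCast_nonneg (M * x % r), Int.natCast_nonneg (M * y % r),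
    Int.emod_nonneg ((M:ℤ) * x) (show (r:ℤ) ≠ 0 by omega),
    Int.emod_nonneg ((M:ℤ) * y) (show (r:ℤ) ≠ 0 by omega)]

lemma ind_one (r m M p k k0 : ℕ) (hr : 0 < r) (hM : 0 < M) (hk0 : k0 < r)
    (hp : r * m < M * p) (hp2 : 2 * p < r * m)
    (h : M * (k * p % r) / r = M * (k0 * p % r) / r) :
    ind (r * m) (2 * p - 1) ((1 + m * (k + r - k0)) % (r * m) * p) = 1 := by
  have hb := box_close r M _ _ hr h
  set x := k * p % r with hx
  set y := k0 * p % r with hy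
  set d : ℤ := (x : ℤ) - y with hd
  have hmd : |(m : ℤ) * d| < p := by
    rw [abs_mul, Nat.abs_cast]
    have h1 : (M : ℤ) * (m * |d|) < M * p := by
      have : (m : ℤ) * (M * |d|) ≤ m * r := by gcongr
      have h2 : (r : ℤ) * m < M * p := by exact_mod_cast hp
      nlinarith
    exact lt_of_mul_lt_mul_left h1 (by positivity)
  rw [abs_lt] at hmd
  have hcong : (((1 + m * (k + r - k0)) % (r * m) * p % (r * m) : ℕ) : ℤ) = p + m * d := by
    have e1 : (p + m * d : ℤ) = (p + m * d) % ((r * m : ℕ) : ℤ) := by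
      rw [Int.emod_eq_of_lt]
      · linarith
      · push_cast
        have : (2 : ℤ) * p < r * m := by exact_mod_cast hp2
        linarith
    rw [e1, Nat.mod_mul_mod]
    push_cast
    rw [Nat.cast_sub (by omega)]
    apply Int.emod_emod_of_dvd _ (dvd_refl _) |>.symm.trans
    rw [Int.emod_emod_of_dvd _ (dvd_refl _)]
    apply Int.ModEq.symm
    rw [Int.modEq_iff_dvd]
    have hx' : (k * p : ℤ) = r * (k * p / r : ℕ) + x := by
      exact_mod_cast (Nat.div_add_mod (k * p) r).symm
    have hy' : (k0 * p : ℤ) = r * (k0 * p / r : ℕ) + y := by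
      exact_mod_cast (Nat.div_add_mod (k0 * p) r).symm
    refine ⟨((k * p / r : ℕ) : ℤ) - (k0 * p / r : ℕ) + p, ?_⟩
    rw [hd]
    push_cast at hx' hy' ⊢
    linear_combination (m : ℤ) * hx' - (m : ℤ) * hy'
  unfold ind
  rw [if_pos]
  constructor <;> omega

lemma core (r m M p q : ℕ) (hr : r.Prime) (hm : 0 < m) (hM : 0 < M)
    (hbig : M * M * 6 < r) (hp : r * m < M * p) (hp2 : 2 * p < r * m)
    (hq : r * m < M * q) (hq2 : 2 * q < r * m) : 5 ≤ Sfun (r * m) p q := by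
  have hr0 := hr.pos
  let f : ℕ → ℕ × ℕ := fun k => (M * (k * p % r) / r, M * (k * q % r) / r)
  have hbox : ∀ z, M * (z % r) / r < M := fun z => by
    rw [Nat.div_lt_iff_lt_mul hr0]
    exact Nat.mul_lt_mul_of_pos_left (Nat.mod_lt _ hr0) hM
  obtain ⟨y, -, hy⟩ := Finset.exists_lt_card_fiber_of_mul_lt_card_of_maps_to
    (s := range r) (t := range M ×ˢ range M) (f := f) (n := 6)
    (by intro k _; simp only [f, mem_product, mem_range]; exact ⟨hbox _, hbox _⟩)
    (by simpa using hbig)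
  set F := (range r).filter (fun k => f k = y) with hF
  obtain ⟨k0, hk0⟩ : F.Nonempty := card_pos.mp (by omega)
  have hk0' := hk0
  rw [hF, mem_filter, mem_range] at hk0'
  obtain ⟨hk0r, hk0y⟩ := hk0'
  let g : ℕ → ℕ := fun k => (1 + m * (k + r - k0)) % (r * m)
  have key : ∀ k ∈ F, ∀ k' ∈ F, (r : ℤ) ∣ (k : ℤ) - k' → k = k' := by
    intro k hk k' hk' hd
    simp only [hF, mem_filter, mem_range] at hk hk'
    have := Int.eq_zero_of_abs_lt_dvd hd (by rw [abs_lt]; omega)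
    omega
  have hcast : ∀ k, ((k + r - k0 : ℕ) : ℤ) = k + r - k0 := fun k => by
    rw [Nat.cast_sub (by omega)]; push_cast; ring
  -- injectivity
  have hinj : ∀ k ∈ F, ∀ k' ∈ F, g k = g k' → k = k' := by
    intro k hk k' hk' h
    apply key k hk k' hk'
    have h1 : (1 + m * (k' + r - k0)) ≡ (1 + m * (k + r - k0)) [MOD r * m] := h.symm
    have h2 := (Nat.modEq_iff_dvd.mp h1)
    push_cast at h2
    rw [hcast, hcast] at h2
    obtain ⟨c, hc⟩ := h2
    refine ⟨c, ?_⟩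
    have hm' : (m : ℤ) ≠ 0 := by omega
    apply mul_left_cancel₀ hm'
    linear_combination hc
  set B := F.filter (fun k => r ∣ 1 + m * (k + r - k0)) with hB
  have hBc : B.card ≤ 1 := by
    rw [card_le_one]
    intro k hk k' hk'
    rw [hB, mem_filter] at hk hk'
    apply key k hk.1 k' hk'.1
    have h1 : (r : ℤ) ∣ 1 + m * (k + r - k0) := by
      have := Int.natCast_dvd_natCast.mpr hk.2
      push_cast at this; rwa [hcast] at this
    have h2 : (r : ℤ) ∣ 1 + m * (k' + r - k0) := by
      have := Int.natCast_dvd_natCast.mpr hk'.2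
      push_cast at this; rwa [hcast] at this
    have h3 : (r : ℤ) ∣ m * (k - k') := by
      have := dvd_sub h1 h2
      have e : (1 + (m : ℤ) * (k + r - k0)) - (1 + m * (k' + r - k0)) = m * (k - k') := by ring
      rwa [e] at this
    rcases (Nat.prime_iff_prime_int.mp hr).dvd_or_dvd h3 with h4 | h4
    · exfalso
      have h5 : (r : ℤ) ∣ 1 := by
        have := dvd_sub h1 (h4.mul_right ((k : ℤ) + r - k0))
        simpa using this
      exact (Nat.prime_iff_prime_int.mp hr).not_dvd_one h5
    · exact h4
  have hG : 5 ≤ (F \ B).card := by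
    have := le_card_sdiff B F
    omega
  have hsub : (F \ B).image g ⊆ Un (r * m) := by
    intro a ha
    obtain ⟨k, hk, rfl⟩ := mem_image.mp ha
    rw [mem_sdiff] at hk
    have hnd : ¬ r ∣ 1 + m * (k + r - k0) := fun h => hk.2 (mem_filter.mpr ⟨hk.1, h⟩)
    have hc : Nat.gcd (g k) (r * m) = 1 := by
      show Nat.gcd ((1 + m * (k + r - k0)) % (r * m)) (r * m) = 1
      rw [← Nat.gcd_rec, Nat.gcd_comm]
      change Nat.Coprime _ _
      apply Nat.Coprime.mul_right
      · exact ((Nat.Prime.coprime_iff_not_dvd hr).mpr hnd).symm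
      · simp
    unfold Un
    rw [mem_filter, mem_Icc]
    have hlt : g k < r * m := Nat.mod_lt _ (by positivity)
    refine ⟨⟨?_, hlt.le⟩, hc⟩
    by_contra h0
    have h0' : g k = 0 := by omega
    rw [h0', Nat.gcd_zero_left] at hc
    have h1r := hr.one_lt
    have h2r : r ≤ r * m := Nat.le_mul_of_pos_right r hm
    linarith
  calc 5 ≤ (F \ B).card := hG
    _ = ((F \ B).image g).card := by
        rw [card_image_of_injOn]
        intro k hk k' hk' h
        exact hinj k (mem_sdiff.mp hk).1 k' (mem_sdiff.mp hk').1 h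
    _ = ∑ a ∈ (F \ B).image g, 1 := by simp
    _ = ∑ a ∈ (F \ B).image g,
          ind (r * m) (2 * p - 1) (a * p) * ind (r * m) (2 * q - 1) (a * q) := by
        apply sum_congr rfl
        intro a ha
        obtain ⟨k, hk, rfl⟩ := mem_image.mp ha
        have hkF := (mem_sdiff.mp hk).1
        rw [hF, mem_filter] at hkF
        have he : f k = f k0 := hkF.2.trans hk0y.symm
        have h1 := congrArg Prod.fst he
        have h2 := congrArg Prod.snd he
        rw [ind_one r m M p k k0 hr0 hM hk0r hp hp2 h1, ind_one r m M q k k0 hr0 hM hk0r hq hq2 h2]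
    _ ≤ Sfun (r * m) p q := sum_le_sum_of_subset hsub

/-- For `η ∈ (0,1/6)` and `θ ∈ (0,1)`, as `n → ∞` along integers with `P⁺(n) ≥ n^θ`,
the proportion of pairs `(p,q) ∈ H_n(η)` with `gcd(q, P⁺(n)) = 1` and `S(p,q) < 5`
tends to `0`. -/
theorem stmt0 (η θ : ℝ) (hη0 : 0 < η) (hη1 : η < 1 / 6) (hθ0 : 0 < θ) (hθ1 : θ < 1) :
    ∀ ε : ℝ, 0 < ε → ∃ N : ℕ, ∀ n : ℕ, N ≤ n → (n : ℝ) ^ θ ≤ (Pplus n : ℝ) →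
      (((Hwin n η).filter
          (fun pq => Nat.gcd pq.2 (Pplus n) = 1 ∧ Sfun n pq.1 pq.2 < 5)).card : ℝ)
        ≤ ε * ((Hwin n η).card : ℝ) := by
  intro ε hε
  obtain ⟨M, hMη⟩ := exists_nat_gt (1 / η)
  have hM : 0 < M := by
    have : (0 : ℝ) < M := lt_trans (by positivity) hMη
    exact_mod_cast this
  have hMη' : 1 < M * η := by rwa [div_lt_iff₀ hη0] at hMη
  have ht := ((tendsto_rpow_atTop hθ0).comp tendsto_natCast_atTop_atTop).eventually_gt_atTop
    ((M * M * 6 : ℕ) : ℝ)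
  obtain ⟨N, hN⟩ := Filter.eventually_atTop.mp ht
  refine ⟨N, fun n hn hP => ?_⟩
  have hbig : M * M * 6 < Pplus n := by
    have := (hN n hn).trans_le hP
    exact_mod_cast this
  have hne : n.primeFactors.Nonempty := by
    rw [nonempty_iff_ne_empty]
    intro h
    simp [Pplus, h] at hbig
  obtain ⟨r, hr, hre⟩ := exists_mem_eq_sup n.primeFactors hne id
  have hPr : Pplus n = r := hre
  rw [hPr] at hbig
  obtain ⟨hrp, ⟨m, rfl⟩, hn0⟩ := Nat.mem_primeFactors.mp hr
  have hm : 0 < m := Nat.pos_of_ne_zero (by rintro rfl; simp at hn0)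
  have hempty : ((Hwin (r * m) η).filter
      (fun pq => Nat.gcd pq.2 (Pplus (r * m)) = 1 ∧ Sfun (r * m) pq.1 pq.2 < 5)) = ∅ := by
    rw [filter_eq_empty_iff]
    rintro ⟨p, q⟩ hpq ⟨-, hS⟩
    simp only [Hwin, mem_filter] at hpq
    obtain ⟨-, hmin, hsum, -⟩ := hpq
    have hn' : (0 : ℝ) < ((r * m : ℕ) : ℝ) := by exact_mod_cast Nat.pos_of_ne_zero hn0
    have aux : ∀ x : ℕ, min p q ≤ x → r * m < M * x := by
      intro x hx
      have hx' : ((min p q : ℕ) : ℝ) ≤ x := by exact_mod_cast hx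
      have h1 : η * ((r * m : ℕ) : ℝ) < x := lt_of_lt_of_le hmin hx'
      have hM0 : (0 : ℝ) < M := by exact_mod_cast hM
      have : ((r * m : ℕ) : ℝ) < ((M * x : ℕ) : ℝ) := by
        push_cast at *
        nlinarith
      exact_mod_cast this
    have := core r m M p q hrp hm hM hbig (aux p (min_le_left _ _)) (by omega)
      (aux q (min_le_right _ _)) (by omega)
    simp only at hS
    omega
  rw [hempty]
  simp only [card_empty, Nat.cast_zero]
  positivity
end

section
/- As n → ∞ along integers n satisfying P⁺(n) ≥ n^{1/log log n}, the proportion of pairs (p,q) ∈ H_n with gcd(q, P⁺(n)) = 1 for which S(p,q) < 5 tends to 0; that is, for every ε > 0 there exists N such that for all n ≥ N with P⁺(n) ≥ n^{1/log log n}, the number of (p,q) ∈ H_n with gcd(q, P⁺(n)) = 1 and S(p,q) < 5 is at most ε · |H_n|. -/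
open Finset

/-- `H_n = {(p,q) ∈ ℤ²_{≥1} : p + q < n/2, gcd(p,q,n) = 1}`. -/
def Hn (n : ℕ) : Finset (ℕ × ℕ) :=
  ((Finset.Icc 1 n) ×ˢ (Finset.Icc 1 n)).filter
    (fun pq => 2 * (pq.1 + pq.2) < n ∧ Nat.gcd (Nat.gcd pq.1 pq.2) n = 1)

lemma aux_mod (n l m p d K : ℕ) (u v : ℕ) (hn : n = l * m) (hK : 0 < K) (hp : n ≤ K * p)
    (h2p : 2 * p < n) (hm : 0 < m)
    (hd : ((d * p : ℕ) : ℤ) ≡ (u : ℤ) - v [ZMOD l])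
    (huv : K * u / l = K * v / l) (hl : 0 < l) :
    1 ≤ ((1 + d * m) * p) % n ∧ ((1 + d * m) * p) % n ≤ 2 * p - 1 := by
  have h1 := Nat.div_add_mod (K * u) l
  have h2 := Nat.div_add_mod (K * v) l
  have h3 := Nat.mod_lt (K * u) hl
  have h4 := Nat.mod_lt (K * v) hl
  rw [huv] at h1
  have hlt1 : (K : ℤ) * ((u : ℤ) - v) < l := by
    zify at h1 h2 h3 h4
    have := Int.emod_nonneg ((K : ℤ) * v) (by positivity : (l : ℤ) ≠ 0)
    nlinarith
  have hlt2 : -(l : ℤ) < (K : ℤ) * ((u : ℤ) - v) := by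
    zify at h1 h2 h3 h4
    have := Int.emod_nonneg ((K : ℤ) * u) (by positivity : (l : ℤ) ≠ 0)
    nlinarith
  set e : ℤ := (u : ℤ) - v with he
  have hnz : (n : ℤ) = l * m := by exact_mod_cast hn
  have hpz : (n : ℤ) ≤ K * p := by exact_mod_cast hp
  have hmz : (0 : ℤ) < m := by exact_mod_cast hm
  have hKz : (0 : ℤ) < K := by exact_mod_cast hK
  have b1 : e * m < p := by
    have : (K : ℤ) * (e * m) < K * p := by nlinarith
    exact lt_of_mul_lt_mul_left this hKz.le
  have b2 : -(p : ℤ) < e * m := by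
    have : (K : ℤ) * (-p) < K * (e * m) := by nlinarith
    exact lt_of_mul_lt_mul_left this hKz.le
  have hcong : (((1 + d * m) * p : ℕ) : ℤ) ≡ p + e * m [ZMOD n] := by
    have h5 : ((d * p : ℕ) : ℤ) * m ≡ e * m [ZMOD (l * m : ℤ)] := Int.ModEq.mul_right' hd
    rw [← hnz] at h5
    have h6 := h5.add_left (p : ℤ)
    have : (((1 + d * m) * p : ℕ) : ℤ) = p + ((d * p : ℕ) : ℤ) * m := by push_cast; ring
    rw [this]; exact h6
  have hmod : ((((1 + d * m) * p) % n : ℕ) : ℤ) = p + e * m := by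
    rw [Int.natCast_mod, hcong]
    exact Int.emod_eq_of_lt (by linarith) (by zify at h2p; linarith)
  constructor
  · have : (0 : ℤ) < ((((1 + d * m) * p) % n : ℕ) : ℤ) := by rw [hmod]; linarith
    exact_mod_cast this
  · have : ((((1 + d * m) * p) % n : ℕ) : ℤ) < 2 * p := by rw [hmod]; linarith
    omega

lemma aux_S (n l K p q : ℕ) (hl : l.Prime) (hln : l ∣ n) (hn : 0 < n) (hK : 0 < K)
    (hbig : K * K * 6 < l) (hp : n ≤ K * p) (hq : n ≤ K * q)
    (hpq : 2 * (p + q) < n) : 5 ≤ Sfun n p q := by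
  classical
  obtain ⟨m, hm⟩ := hln
  have hm0 : 0 < m := by
    rcases Nat.eq_zero_or_pos m with h | h
    · subst h; simp at hm; omega
    · exact h
  have hl0 := hl.pos
  let f : ℕ → ℕ × ℕ := fun j => (K * ((j * p) % l) / l, K * ((j * q) % l) / l)
  have hmaps : ∀ j ∈ range l, f j ∈ range K ×ˢ range K := by
    intro j _
    have h1 := Nat.mod_lt (j * p) hl0
    have h2 := Nat.mod_lt (j * q) hl0
    simp only [f, mem_product, mem_range]
    constructor
    · rw [Nat.div_lt_iff_lt_mul hl0]; exact Nat.mul_lt_mul_of_pos_left h1 hK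
    · rw [Nat.div_lt_iff_lt_mul hl0]; exact Nat.mul_lt_mul_of_pos_left h2 hK
  obtain ⟨y, -, hy⟩ := Finset.exists_lt_card_fiber_of_mul_lt_card_of_maps_to (n := 6) hmaps
    (by simpa using hbig)
  set A := (range l).filter (fun j => f j = y) with hA
  have hne : A.Nonempty := card_pos.mp (by omega)
  set j0 := A.min' hne with hj0
  have hj0A : j0 ∈ A := A.min'_mem hne
  let D := A.image (fun j => j - j0)
  have hle : ∀ j ∈ A, j0 ≤ j := fun j hj => A.min'_le j hj
  have hD : 6 < D.card := by
    rw [Finset.card_image_of_injOn]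
    · exact hy
    · intro a ha b hb hab
      have := hle a ha
      have := hle b hb
      simp only at hab
      omega
  have hDlt : ∀ d ∈ D, d < l := by
    intro d hd
    obtain ⟨j, hj, rfl⟩ := mem_image.mp hd
    have := (mem_filter.mp hj).1
    simp at this
    omega
  have hbadcop : ∀ d, ¬ Nat.gcd (1 + d * m) n = 1 → (l ∣ 1 + d * m) ∧ ¬ l ∣ m := by
    intro d hd
    obtain ⟨r, hr, hr1, hr2⟩ := Nat.Prime.not_coprime_iff_dvd.mp hd
    have hrm : ¬ r ∣ m := by
      intro h
      have : r ∣ 1 := (Nat.dvd_add_left (h.mul_left d)).mp hr1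
      exact hr.one_lt.ne' (Nat.dvd_one.mp this)
    rw [hm] at hr2
    have hrl : r ∣ l := (hr.dvd_mul.mp hr2).resolve_right hrm
    have : r = l := (Nat.prime_dvd_prime_iff_eq hr hl).mp hrl
    subst this
    exact ⟨hr1, hrm⟩
  have hB : (D.filter (fun d => ¬ Nat.gcd (1 + d * m) n = 1)).card ≤ 1 := by
    rw [Finset.card_le_one]
    intro a ha b hb
    rw [mem_filter] at ha hb
    obtain ⟨ha1, ha2⟩ := hbadcop a ha.2
    obtain ⟨hb1, -⟩ := hbadcop b hb.2
    have hcop : Nat.Coprime l m := (Nat.Prime.coprime_iff_not_dvd hl).mpr ha2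
    have h1 : 1 + a * m ≡ 1 + b * m [MOD l] :=
      ((Nat.modEq_zero_iff_dvd).mpr ha1).trans ((Nat.modEq_zero_iff_dvd).mpr hb1).symm
    have h2 : a * m ≡ b * m [MOD l] := Nat.ModEq.add_left_cancel' 1 h1
    have h3 : a ≡ b [MOD l] := Nat.ModEq.cancel_right_of_coprime hcop h2
    exact Nat.ModEq.eq_of_lt_of_lt h3 (hDlt a ha.1) (hDlt b hb.1)
  have hsplit := Finset.card_filter_add_card_filter_not (s := D)
    (fun d => Nat.gcd (1 + d * m) n = 1)
  set G := D.filter (fun d => Nat.gcd (1 + d * m) n = 1) with hG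
  let T := G.image (fun d => 1 + d * m)
  have hT : 5 ≤ T.card := by
    rw [Finset.card_image_of_injective]
    · omega
    · intro a b hab
      simp only at hab
      exact Nat.eq_of_mul_eq_mul_right hm0 (by omega)
  have hTU : T ⊆ Un n := by
    intro a ha
    obtain ⟨d, hd, rfl⟩ := mem_image.mp ha
    rw [hG, mem_filter] at hd
    have := hDlt d hd.1
    simp only [Un, mem_filter, mem_Icc]
    refine ⟨⟨by omega, ?_⟩, hd.2⟩
    rw [hm]
    have : (d + 1) * m ≤ l * m := Nat.mul_le_mul_right m this
    nlinarith
  have key : ∀ d ∈ D, ∀ x : ℕ, ∀ j ∈ A, d = j - j0 →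
      ((d * x : ℕ) : ℤ) ≡ (((j * x) % l : ℕ) : ℤ) - (((j0 * x) % l : ℕ) : ℤ) [ZMOD l] := by
    intro d _ x j hj hdj
    have h1 := hle j hj
    have : ((d * x : ℕ) : ℤ) = ((j * x : ℕ) : ℤ) - ((j0 * x : ℕ) : ℤ) := by
      subst hdj; push_cast [h1]; ring
    rw [this, Int.natCast_mod, Int.natCast_mod]
    exact (Int.ModEq.sub (Int.mod_modEq _ _) (Int.mod_modEq _ _)).symm
  calc 5 ≤ T.card := hT
    _ = ∑ a ∈ T, 1 := by simp
    _ ≤ ∑ a ∈ T, ind n (2 * p - 1) (a * p) * ind n (2 * q - 1) (a * q) := by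
        apply Finset.sum_le_sum
        intro a ha
        obtain ⟨d, hd, rfl⟩ := mem_image.mp ha
        rw [hG, mem_filter] at hd
        obtain ⟨j, hj, hjd⟩ := mem_image.mp hd.1
        have hfj : f j = f j0 := by
          rw [(mem_filter.mp hj).2, (mem_filter.mp hj0A).2]
        simp only [f, Prod.mk.injEq] at hfj
        have e1 := aux_mod n l m p d K _ _ hm hK hp (by omega) hm0
          (key d hd.1 p j hj hjd.symm) hfj.1 hl0
        have e2 := aux_mod n l m q d K _ _ hm hK hq (by omega) hm0
          (key d hd.1 q j hj hjd.symm) hfj.2 hl0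
        simp only [ind]
        rw [if_pos e1, if_pos e2]
    _ ≤ Sfun n p q := Finset.sum_le_sum_of_subset hTU

lemma aux_sum (M : ℕ) : ∑ r ∈ Icc 2 M, (1 : ℝ) / (r : ℝ) ^ 2 ≤ 3 / 4 := by
  have : ∀ M : ℕ, 2 ≤ M → ∑ r ∈ Icc 2 M, (1 : ℝ) / (r : ℝ) ^ 2 ≤ 3 / 4 - 1 / M := by
    intro M hM
    induction M, hM using Nat.le_induction with
    | base => norm_num
    | succ k hk ih =>
      rw [Finset.sum_Icc_succ_top (by omega)]
      have hk0 : (0 : ℝ) < k := by positivity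
      have : (1 : ℝ) / ((k + 1 : ℕ) : ℝ) ^ 2 ≤ 1 / k - 1 / ((k + 1 : ℕ) : ℝ) := by
        push_cast
        rw [div_sub_div _ _ (by positivity) (by positivity), div_le_div_iff₀ (by positivity) (by positivity)]
        nlinarith
      linarith
  rcases le_or_gt 2 M with h | h
  · have h1 := this M h
    have : (0 : ℝ) ≤ 1 / M := by positivity
    linarith
  · rw [Finset.Icc_eq_empty (by omega)]; norm_num

lemma aux_H (n : ℕ) (hn : 8 ≤ n) : (n : ℝ) ^ 2 / 256 ≤ ((Hn n).card : ℝ) := by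
  classical
  set M := (n - 1) / 4 with hM
  let B := Icc 1 M ×ˢ Icc 1 M
  let C : ℕ → Finset (ℕ × ℕ) := fun r =>
    ((Icc 1 M).filter (fun x => r ∣ x)) ×ˢ ((Icc 1 M).filter (fun x => r ∣ x))
  have hsub : B ⊆ Hn n ∪ (Icc 2 M).biUnion C := by
    rintro ⟨p, q⟩ h
    simp only [B, mem_product, mem_Icc] at h
    rw [mem_union]
    by_cases hg : Nat.gcd (Nat.gcd p q) n = 1
    · left
      simp only [Hn, mem_filter, mem_product, mem_Icc]
      refine ⟨⟨⟨?_, ?_⟩, ?_, ?_⟩, ?_, hg⟩ <;> omega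
    · right
      rw [mem_biUnion]
      have d1 : Nat.gcd (Nat.gcd p q) n ∣ p := (Nat.gcd_dvd_left _ _).trans (Nat.gcd_dvd_left _ _)
      have d2 : Nat.gcd (Nat.gcd p q) n ∣ q := (Nat.gcd_dvd_left _ _).trans (Nat.gcd_dvd_right _ _)
      have := Nat.le_of_dvd (by omega) d1
      have := Nat.pos_of_dvd_of_pos d1 (by omega)
      refine ⟨Nat.gcd (Nat.gcd p q) n, ?_, ?_⟩
      · rw [mem_Icc]; omega
      · simp only [C, mem_product, mem_filter, mem_Icc]
        exact ⟨⟨h.1, d1⟩, h.2, d2⟩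
  have hc1 : B.card ≤ (Hn n).card + ∑ r ∈ Icc 2 M, (C r).card :=
    (card_le_card hsub).trans ((card_union_le _ _).trans
      (Nat.add_le_add_left card_biUnion_le _))
  have hBc : B.card = M * M := by simp [B]
  have hCc : ∀ r, ((C r).card : ℝ) ≤ (M : ℝ) ^ 2 * (1 / (r : ℝ) ^ 2) := by
    intro r
    have h1 : ((Icc 1 M).filter (fun x => r ∣ x)).card = M / r := by
      have := Nat.Ioc_filter_dvd_card_eq_div M r
      rw [← this]; rfl
    simp only [C, card_product, h1]
    have h2 : ((M / r : ℕ) : ℝ) ≤ (M : ℝ) / r := Nat.cast_div_le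
    push_cast
    calc ((M / r : ℕ) : ℝ) * ((M / r : ℕ) : ℝ) ≤ ((M : ℝ) / r) * ((M : ℝ) / r) := by gcongr
      _ = _ := by ring
  have hc2 : ((M * M : ℕ) : ℝ) ≤ (Hn n).card + (M : ℝ) ^ 2 * (3 / 4) := by
    rw [← hBc]
    calc (B.card : ℝ) ≤ ((Hn n).card : ℝ) + ∑ r ∈ Icc 2 M, ((C r).card : ℝ) := by exact_mod_cast hc1
      _ ≤ (Hn n).card + ∑ r ∈ Icc 2 M, (M : ℝ) ^ 2 * (1 / (r : ℝ) ^ 2) := by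
          gcongr with r _; exact hCc r
      _ ≤ _ := by
          rw [← Finset.mul_sum]; gcongr; exact aux_sum M
  have hMn : (n : ℝ) ≤ 8 * M := by
    have : n ≤ 8 * M := by omega
    exact_mod_cast this
  push_cast at hc2
  have : (n : ℝ) ^ 2 ≤ (8 * M) ^ 2 := by gcongr
  nlinarith

lemma aux_grow (L : ℝ) (hL : 0 < L) : ∃ N : ℕ, ∀ n : ℕ, N ≤ n →
    L < (n : ℝ) ^ (1 / Real.log (Real.log n)) := by
  have h1 : ∀ᶠ y : ℝ in Filter.atTop, ‖Real.log y‖ ≤ L⁻¹ * ‖y‖ :=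
    Real.isLittleO_log_id_atTop.bound (by positivity)
  have h2 : ∀ᶠ y : ℝ in Filter.atTop, (1 : ℝ) < y := Filter.eventually_gt_atTop 1
  have ht : Filter.Tendsto (fun n : ℕ => Real.log (n : ℝ)) Filter.atTop Filter.atTop :=
    Real.tendsto_log_atTop.comp tendsto_natCast_atTop_atTop
  obtain ⟨N, hN⟩ := Filter.eventually_atTop.mp (ht.eventually (h1.and h2))
  refine ⟨max N 1, fun n hn => ?_⟩
  obtain ⟨h3, h4⟩ := hN n (le_trans (le_max_left _ _) hn)
  have hn0 : (0 : ℝ) < n := by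
    have : 1 ≤ n := le_trans (le_max_right _ _) hn
    exact_mod_cast this
  have h5 : 0 < Real.log (Real.log n) := Real.log_pos h4
  rw [Real.norm_of_nonneg h5.le, Real.norm_of_nonneg (by linarith)] at h3
  rw [Real.rpow_def_of_pos hn0]
  have h6 : L ≤ Real.log n * (1 / Real.log (Real.log n)) := by
    rw [mul_one_div, le_div_iff₀ h5]
    calc L * Real.log (Real.log n) ≤ L * (L⁻¹ * Real.log n) := by gcongr
      _ = Real.log n := by field_simp
  have h7 := Real.add_one_le_exp (Real.log n * (1 / Real.log (Real.log n)))
  linarith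

lemma aux_Pplus (n : ℕ) (hn : 2 ≤ n) : (Pplus n).Prime ∧ Pplus n ∣ n := by
  have hne : n.primeFactors.Nonempty := Nat.nonempty_primeFactors.mpr (by omega)
  obtain ⟨r, hr, hr2⟩ := Finset.exists_mem_eq_sup n.primeFactors hne id
  have : Pplus n = r := hr2
  rw [this]
  exact ⟨Nat.prime_of_mem_primeFactors hr, Nat.dvd_of_mem_primeFactors hr⟩

/-- As `n → ∞` along integers with `P⁺(n) ≥ n^{1/log log n}`, the proportion of pairs
`(p,q) ∈ H_n` with `gcd(q, P⁺(n)) = 1` and `S(p,q) < 5` tends to `0`. -/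
theorem stmt1 :
    ∀ ε : ℝ, 0 < ε → ∃ N : ℕ, ∀ n : ℕ, N ≤ n →
      (n : ℝ) ^ (1 / Real.log (Real.log n)) ≤ (Pplus n : ℝ) →
      (((Hn n).filter
          (fun pq => Nat.gcd pq.2 (Pplus n) = 1 ∧ Sfun n pq.1 pq.2 < 5)).card : ℝ)
        ≤ ε * ((Hn n).card : ℝ) := by
  classical
  intro ε hε
  obtain ⟨K, hKε⟩ := exists_nat_gt (512 / ε)
  have hK0 : 0 < K := by
    have : (0 : ℝ) < K := lt_trans (by positivity) hKε
    exact_mod_cast this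
  obtain ⟨N, hN⟩ := aux_grow ((K * K * 6 : ℕ) : ℝ) (by positivity)
  refine ⟨max N 8, fun n hn hP => ?_⟩
  have hn8 : 8 ≤ n := le_trans (le_max_right _ _) hn
  have hbig : K * K * 6 < Pplus n := by
    exact_mod_cast lt_of_lt_of_le (hN n (le_trans (le_max_left _ _) hn)) hP
  obtain ⟨hl, hln⟩ := aux_Pplus n (by omega)
  have hsub : (Hn n).filter (fun pq => Nat.gcd pq.2 (Pplus n) = 1 ∧ Sfun n pq.1 pq.2 < 5) ⊆
      (Icc 1 (n / K) ×ˢ Icc 1 n) ∪ (Icc 1 n ×ˢ Icc 1 (n / K)) := by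
    rintro ⟨p, q⟩ h
    simp only [Hn, mem_filter, mem_product, mem_Icc] at h
    obtain ⟨⟨⟨⟨hp1, hp2⟩, hq1, hq2⟩, hpq, -⟩, -, hS⟩ := h
    simp only [mem_union, mem_product, mem_Icc, Nat.le_div_iff_mul_le hK0]
    by_contra hcon
    have hp : n ≤ K * p := by
      by_contra hlt
      exact hcon (Or.inl ⟨⟨hp1, by nlinarith⟩, hq1, hq2⟩)
    have hq : n ≤ K * q := by
      by_contra hlt
      exact hcon (Or.inr ⟨⟨hp1, hp2⟩, hq1, by nlinarith⟩)
    have := aux_S n (Pplus n) K p q hl hln (by omega) hK0 hbig hp hq hpq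
    omega
  have hcard := (card_le_card hsub).trans (card_union_le _ _)
  simp only [card_product, Nat.card_Icc, Nat.add_sub_cancel] at hcard
  have hdiv : ((n / K : ℕ) : ℝ) ≤ (n : ℝ) / K := Nat.cast_div_le
  have hKr : (0 : ℝ) < K := by exact_mod_cast hK0
  have hH := aux_H n hn8
  have hfin : (2 : ℝ) / K ≤ ε / 256 := by
    rw [div_lt_iff₀ hε] at hKε
    rw [div_le_div_iff₀ hKr (by norm_num)]
    linarith
  calc _ ≤ (((n / K) * n + n * (n / K) : ℕ) : ℝ) := by exact_mod_cast hcard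
    _ = 2 * n * ((n / K : ℕ) : ℝ) := by push_cast; ring
    _ ≤ 2 * n * ((n : ℝ) / K) := by gcongr
    _ = (2 / K) * (n : ℝ) ^ 2 := by ring
    _ ≤ (ε / 256) * (n : ℝ) ^ 2 := by gcongr
    _ = ε * ((n : ℝ) ^ 2 / 256) := by ring
    _ ≤ _ := by gcongr
end

section
/- Let n ≥ 2, let P = P⁺(n) be the largest prime divisor of n, write n = P^α m with α = v_P(n) ≥ 1 and gcd(P, m) = 1, and set d = P^α. Let q be an integer with 1 ≤ 2q−1 ≤ n−1 and gcd(q, P) = 1. Then for any real parameter R ≥ 2, there exists a set B_q(R) ⊆ (ℤ/dℤ)^× with |B_q(R)| ≤ φ(d)/R such that for every integer p with 1 ≤ 2p−1 ≤ n−1, gcd(p, P) = 1, and p mod d ∉ B_q(R), one has |E(p,q)| ≤ 9 R φ(n) (1 + log n)² / P. -/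
open Finset

/-- The error term `E(p,q) = S(p,q) − M(p,q)` where `M(p,q) = (2p−1)(2q−1)φ(n)/n²`. -/
noncomputable def Efun (n p q : ℕ) : ℝ :=
  (Sfun n p q : ℝ) - ((2 * p - 1 : ℕ) : ℝ) * ((2 * q - 1 : ℕ) : ℝ) * (Nat.totient n : ℝ) / (n : ℝ) ^ 2


lemma aux_sum_range {M : Type*} [AddCommMonoid M] (n : ℕ) [NeZero n] (f : ZMod n → M) :
    ∑ x : ZMod n, f x = ∑ h ∈ range n, f (h : ZMod n) := by
  symm
  refine Finset.sum_bij (fun a _ => (a : ZMod n)) (by simp) ?_ ?_ (by simp)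
  · intro a ha b hb h
    rw [Finset.mem_range] at ha hb
    have := congrArg ZMod.val h
    rwa [ZMod.val_cast_of_lt ha, ZMod.val_cast_of_lt hb] at this
  · intro b _
    exact ⟨b.val, Finset.mem_range.2 (ZMod.val_lt b), by simp⟩

lemma aux_sum_Icc {M : Type*} [AddCommMonoid M] (n : ℕ) [NeZero n] (f : ZMod n → M) :
    ∑ a ∈ Icc 1 n, f (a : ZMod n) = ∑ x : ZMod n, f x := by
  rw [← Equiv.sum_comp (Equiv.addRight (1 : ZMod n)) f, aux_sum_range]
  simp only [Equiv.coe_addRight]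
  have := Finset.sum_Ico_add' (fun i : ℕ => f (i : ZMod n)) 0 n 1
  rw [Finset.range_eq_Ico]
  push_cast at this
  rw [this]
  rfl

noncomputable def cf (n : ℕ) [NeZero n] (K : ℕ) (h : ZMod n) : ℂ :=
  (1 / (n : ℂ)) * ∑ y ∈ Icc 1 K, (ZMod.stdAddChar (N := n)) (-(h * (y : ZMod n)))

lemma ind_fourier (n : ℕ) [NeZero n] (K x : ℕ) (hK : K ≤ n - 1) :
    (ind n K x : ℂ) = ∑ h ∈ range n, cf n K h * (ZMod.stdAddChar (N := n)) ((h : ZMod n) * x) := by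
  have hn : 0 < n := Nat.pos_of_ne_zero (NeZero.ne n)
  have hnC : (n : ℂ) ≠ 0 := by exact_mod_cast (NeZero.ne n)
  rw [← aux_sum_range n (fun h => cf n K h * (ZMod.stdAddChar (N := n)) (h * x))]
  have h1 : ∀ h : ZMod n, cf n K h * (ZMod.stdAddChar (N := n)) (h * x) =
      ∑ y ∈ Icc 1 K, (1 / (n : ℂ)) * (ZMod.stdAddChar (N := n)) (h * ((x : ZMod n) - y)) := by
    intro h
    unfold cf
    rw [mul_assoc, Finset.sum_mul, Finset.mul_sum]
    apply Finset.sum_congr rfl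
    intro y _
    rw [← AddChar.map_add_eq_mul]
    congr 2
    ring
  simp_rw [h1]
  rw [Finset.sum_comm]
  have h2 : ∀ y ∈ Icc 1 K, (1 / (n : ℂ)) * ∑ h : ZMod n, (ZMod.stdAddChar (N := n)) (h * ((x : ZMod n) - y))
      = if x % n = y then 1 else 0 := by
    intro y hy
    rw [Finset.mem_Icc] at hy
    rw [AddChar.sum_mulShift _ (ZMod.isPrimitive_stdAddChar n)]
    have : ((x : ZMod n) - y = 0) ↔ x % n = y := by
      rw [sub_eq_zero, ZMod.natCast_eq_natCast_iff, Nat.ModEq, Nat.mod_eq_of_lt (a := y) (by omega)]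
    simp only [this, ZMod.card]
    split_ifs
    · field_simp
    · simp
  simp_rw [← Finset.mul_sum] at h2 ⊢
  rw [Finset.mul_sum, Finset.sum_congr rfl h2, Finset.sum_ite_eq]
  unfold ind
  simp only [Finset.mem_Icc]
  split_ifs <;> simp

noncomputable def wt (n h : ℕ) : ℝ :=
  if h = 0 then 1 else (1 / 2) * (1 / (h : ℝ) + 1 / ((n : ℝ) - h))

lemma wt_nonneg (n h : ℕ) (hh : h < n) : 0 ≤ wt n h := by
  unfold wt
  have : (h : ℝ) < n := by exact_mod_cast hh
  split_ifs
  · norm_num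
  · have : 0 < (n : ℝ) - h := by linarith
    positivity

lemma char_sub_one (n : ℕ) [NeZero n] (h : ℕ) (h0 : h ≠ 0) (hh : h < n) :
    2 / ((n : ℝ) * wt n h) ≤ 2 * ‖(ZMod.stdAddChar (N := n)) (h : ZMod n) - 1‖ / 2 ∧
    0 < wt n h := by
  have hn : (0 : ℝ) < n := by exact_mod_cast (by omega : 0 < n)
  have hp : (0 : ℝ) < h := by exact_mod_cast Nat.pos_of_ne_zero h0
  have hq : (0 : ℝ) < (n : ℝ) - h := by
    have : (h : ℝ) < n := by exact_mod_cast hh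
    linarith
  have hw : wt n h = n / (2 * h * (n - h)) := by
    unfold wt
    rw [if_neg h0]
    field_simp
    ring
  have hval : ‖(ZMod.stdAddChar (N := n)) (h : ZMod n) - 1‖ = 2 * Real.sin (Real.pi * h / n) := by
    have := ZMod.stdAddChar_coe (N := n) (h : ℤ)
    push_cast at this
    rw [this]
    have e : (2 * (Real.pi : ℂ) * Complex.I * h / n) = Complex.I * ((2 * Real.pi * h / n : ℝ) : ℂ) := by
      push_cast; ring
    rw [e, Complex.norm_exp_I_mul_ofReal_sub_one, Real.norm_of_nonneg]
    · congr 2; ring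
    · have : 0 ≤ Real.sin (2 * Real.pi * h / n / 2) := by
        apply Real.sin_nonneg_of_nonneg_of_le_pi
        · positivity
        · rw [div_div, div_le_iff₀ (by positivity)]
          nlinarith [Real.pi_pos]
      linarith
  refine ⟨?_, by rw [hw]; positivity⟩
  rw [hval, hw]
  have pp := Real.pi_pos
  have key : 2 * h * (n - h) / (n : ℝ) ^ 2 ≤ Real.sin (Real.pi * h / n) := by
    rcases le_total ((h : ℝ) * 2) n with hc | hc
    · have := Real.mul_le_sin (x := Real.pi * h / n) (by positivity) (by
        rw [div_le_iff₀ hn]; nlinarith)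
      refine le_trans ?_ this
      have e : 2 / Real.pi * (Real.pi * h / n) = 2 * h / n := by field_simp
      rw [e, div_le_div_iff₀ (by positivity) hn]
      have : 0 ≤ (h : ℝ) * n * h := by positivity
      nlinarith
    · have := Real.mul_le_sin (x := Real.pi - Real.pi * h / n) (by
        rw [sub_nonneg, div_le_iff₀ hn]; nlinarith) (by
        have : Real.pi / 2 ≤ Real.pi * h / n := by
          rw [le_div_iff₀ hn]; nlinarith
        linarith)
      rw [Real.sin_pi_sub] at this
      refine le_trans ?_ this
      have e : 2 / Real.pi * (Real.pi - Real.pi * h / n) = 2 * (n - h) / n := by field_simp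
      rw [e, div_le_div_iff₀ (by positivity) hn]
      have : 0 ≤ ((n : ℝ) - h) * n * (n - h) := by positivity
      nlinarith
  have e2 : 2 / ((n : ℝ) * (n / (2 * h * (n - h)))) = 2 * (2 * h * (n - h) / (n : ℝ) ^ 2) := by
    field_simp
  rw [e2]
  linarith

lemma cf_norm (n : ℕ) [NeZero n] (K h : ℕ) (hK : K ≤ n - 1) (hh : h < n) :
    ‖cf n K h‖ ≤ wt n h := by
  have hn : (0 : ℝ) < n := by exact_mod_cast (by omega : 0 < n)
  unfold cf
  rw [norm_mul]
  have e0 : ‖(1 / (n : ℂ))‖ = 1 / (n : ℝ) := by simp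
  rw [e0]
  by_cases h0 : h = 0
  · subst h0
    have hK' : (K : ℝ) ≤ n := by exact_mod_cast (by omega : K ≤ n)
    simp [wt]
    rw [inv_mul_le_iff₀ hn]
    linarith
  · obtain ⟨h1, h2⟩ := char_sub_one n h h0 hh
    set z := (ZMod.stdAddChar (N := n)) (h : ZMod n) with hz
    have hzn : ‖z‖ = 1 := AddChar.norm_apply _ _
    have hz0 : z ≠ 0 := by intro h; simp [h] at hzn
    have hz1 : 0 < ‖z - 1‖ := by
      have : 0 < 2 / ((n : ℝ) * wt n h) := by positivity
      linarith
    have hterm : ∀ y ∈ Icc 1 K, (ZMod.stdAddChar (N := n)) (-((h : ZMod n) * (y : ZMod n))) = z⁻¹ ^ y := by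
      intro y _
      rw [AddChar.map_neg_eq_inv, mul_comm, ← nsmul_eq_mul, AddChar.map_nsmul_eq_pow, inv_pow]
    rw [Finset.sum_congr rfl hterm]
    have tel : (∑ y ∈ Icc 1 K, z⁻¹ ^ y) * (z - 1) = 1 - z⁻¹ ^ K := by
      clear * - hz0
      induction K with
      | zero => simp
      | succ k ih =>
        rw [Finset.sum_Icc_succ_top (by omega), add_mul, ih, pow_succ]
        field_simp
        ring
    have hb : ‖∑ y ∈ Icc 1 K, z⁻¹ ^ y‖ * ‖z - 1‖ ≤ 2 := by
      rw [← norm_mul, tel]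
      refine (norm_sub_le _ _).trans ?_
      simp [hzn]; norm_num
    rw [one_div, inv_mul_le_iff₀ hn]
    have h3 : 2 ≤ ‖z - 1‖ * (n * wt n h) := by
      rw [div_le_iff₀ (by positivity)] at h1
      linarith
    by_contra hc
    push Not at hc
    nlinarith [mul_lt_mul_of_pos_left hc hz1]

noncomputable def Gs (n : ℕ) [NeZero n] (t : ZMod n) : ℂ :=
  ∑ a ∈ Un n, (ZMod.stdAddChar (N := n)) ((a : ZMod n) * t)

lemma S_expand (n : ℕ) [NeZero n] (p q : ℕ) (hp : 2 * p - 1 ≤ n - 1) (hq : 2 * q - 1 ≤ n - 1) :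
    (Sfun n p q : ℂ) = ∑ h ∈ range n, ∑ k ∈ range n,
      cf n (2 * p - 1) h * cf n (2 * q - 1) k * Gs n ((h * p + k * q : ℕ) : ZMod n) := by
  unfold Sfun Gs
  push_cast
  simp_rw [ind_fourier n _ _ hp, ind_fourier n _ _ hq, Finset.sum_mul_sum, Finset.mul_sum]
  rw [Finset.sum_comm]
  apply Finset.sum_congr rfl
  intro h _
  rw [Finset.sum_comm]
  apply Finset.sum_congr rfl
  intro k _
  apply Finset.sum_congr rfl
  intro a _
  have : ((a : ZMod n) * (h * p + k * q)) = (h : ZMod n) * ((a * p : ℕ) : ZMod n) + k * ((a * q : ℕ) : ZMod n) := by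
    push_cast; ring
  rw [this, AddChar.map_add_eq_mul]
  ring

lemma count_cop (m k : ℕ) : ((Ico 1 (1 + m * k)).filter (fun a => m.Coprime a)).card = k * m.totient := by
  induction k with
  | zero => simp
  | succ k ih =>
    have := Nat.filter_coprime_Ico_eq_totient m (1 + m * k)
    have hu : Ico 1 (1 + m * (k + 1)) = Ico 1 (1 + m * k) ∪ Ico (1 + m * k) (1 + m * k + m) := by
      rw [Finset.Ico_union_Ico_eq_Ico (by omega) (by omega)]
      congr 1; ring
    rw [hu, Finset.filter_union, Finset.card_union_of_disjoint, ih, this]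
    · ring
    · apply Finset.disjoint_filter_filter
      exact Finset.Ico_disjoint_Ico_consecutive _ _ _

lemma Un_card (n : ℕ) : (Un n).card = n.totient := by
  have := count_cop n 1
  rw [one_mul, mul_one] at this
  rw [← this]
  unfold Un
  congr 1
  ext a
  simp only [Finset.mem_filter, Finset.mem_Icc, Finset.mem_Ico, Nat.coprime_comm (m := n), Nat.Coprime]
  omega

lemma Gs_le (n : ℕ) [NeZero n] (t : ZMod n) : ‖Gs n t‖ ≤ n.totient := by
  unfold Gs
  refine (norm_sum_le _ _).trans ?_
  simp [Un_card]

lemma Gs_le' (n : ℕ) [NeZero n] (P α m : ℕ) (hP : P.Prime) (hα : 1 ≤ α) (hnm : n = P ^ α * m)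
    (hPm : Nat.gcd P m = 1) (t : ℕ) (ht : ¬ P ^ α ∣ t) :
    ‖Gs n (t : ZMod n)‖ ≤ n.totient / ((P : ℝ) - 1) := by
  have hn0 : n ≠ 0 := NeZero.ne n
  have hm0 : m ≠ 0 := by rintro rfl; simp at hnm; exact hn0 hnm
  have hmn : m ∣ n := ⟨P ^ α, by rw [hnm]; ring⟩
  set e := ZMod.stdAddChar (N := n) with he
  set A := (Icc 1 n).filter (fun a => m.Coprime a) with hA
  -- the full sum vanishes
  have hzero : ∑ a ∈ A, e ((a : ZMod n) * t) = 0 := by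
    classical
    set f : ZMod n → ℂ := fun x => if IsUnit (ZMod.castHom hmn (ZMod m) x) then e (x * t) else 0 with hf
    have h1 : ∑ a ∈ A, e ((a : ZMod n) * t) = ∑ x : ZMod n, f x := by
      rw [← aux_sum_Icc, hA, Finset.sum_filter]
      apply Finset.sum_congr rfl
      intro a _
      simp only [hf, map_natCast, ZMod.isUnit_iff_coprime, Nat.coprime_comm (m := m)]
    rw [h1]
    have h2 : ∑ x : ZMod n, f x = e ((m : ZMod n) * t) * ∑ x : ZMod n, f x := by
      conv_lhs => rw [← Equiv.sum_comp (Equiv.addRight (m : ZMod n)) f]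
      rw [Finset.mul_sum]
      apply Finset.sum_congr rfl
      intro x _
      simp only [hf, Equiv.coe_addRight, map_add, map_natCast, CharP.cast_eq_zero, add_zero]
      split_ifs
      · rw [add_mul, AddChar.map_add_eq_mul]; ring
      · simp
    have h3 : e ((m : ZMod n) * t) ≠ 1 := by
      intro h
      rw [← AddChar.map_zero_eq_one e] at h
      have := ZMod.injective_stdAddChar h
      rw [← Nat.cast_mul, ZMod.natCast_eq_zero_iff, hnm, mul_comm] at this
      exact ht (Nat.dvd_of_mul_dvd_mul_left (Nat.pos_of_ne_zero hm0) this)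
    have h4 : (1 - e ((m : ZMod n) * t)) * ∑ x : ZMod n, f x = 0 := by
      rw [sub_mul, one_mul, ← h2, sub_self]
    rcases mul_eq_zero.1 h4 with h | h
    · exact absurd (sub_eq_zero.1 h).symm h3
    · exact h
  have hU : Un n = A.filter (fun a => ¬ P ∣ a) := by
    ext a
    simp only [Un, hA, Finset.mem_filter, and_assoc]
    refine and_congr_right fun _ => ?_
    change a.Coprime n ↔ _
    rw [hnm, Nat.coprime_mul_iff_right, Nat.coprime_pow_right_iff hα, and_comm, Nat.coprime_comm,
      Nat.coprime_comm (n := a) (m := P), hP.coprime_iff_not_dvd]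
  have hsplit := Finset.sum_filter_add_sum_filter_not A (fun a => P ∣ a) (fun a => e ((a : ZMod n) * t))
  rw [hzero, ← hU] at hsplit
  have hG : Gs n (t : ZMod n) = - ∑ a ∈ A.filter (fun a => P ∣ a), e ((a : ZMod n) * t) := by
    unfold Gs
    linear_combination hsplit
  have hcA : A.card = P ^ α * m.totient := by
    rw [← count_cop, mul_comm m, ← hnm, add_comm]
    rfl
  have hc := Finset.card_filter_add_card_filter_not (s := A) (fun a => P ∣ a)
  rw [← hU, Un_card, hcA] at hc
  have htot : n.totient = P ^ (α - 1) * (P - 1) * m.totient := by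
    rw [hnm, Nat.totient_mul ((Nat.Coprime.pow_left _ hPm)), Nat.totient_prime_pow hP hα]
  have hPr : (1 : ℝ) < P := by exact_mod_cast hP.one_lt
  have hpow : (P : ℝ) ^ α = P ^ (α - 1) * P := by
    rw [← pow_succ]; congr 1; omega
  have htotR : (n.totient : ℝ) = P ^ (α - 1) * (P - 1) * m.totient := by
    rw [htot]; push_cast [Nat.cast_sub hP.one_le]; ring
  have hcR : ((A.filter (fun a => P ∣ a)).card : ℝ) + n.totient = P ^ α * m.totient := by exact_mod_cast hc
  rw [hG, norm_neg]
  refine (norm_sum_le _ _).trans ?_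
  have : ∀ a ∈ A.filter (fun a => P ∣ a), ‖e ((a : ZMod n) * t)‖ = 1 := fun a _ => AddChar.norm_apply _ _
  rw [Finset.sum_congr rfl this]
  simp only [Finset.sum_const, nsmul_eq_mul, mul_one]
  rw [le_div_iff₀ (by linarith)]
  rw [htotR, hpow] at hcR
  rw [htotR]
  have : ((A.filter (fun a => P ∣ a)).card : ℝ) = P ^ (α - 1) * m.totient := by linear_combination hcR
  rw [this]
  apply le_of_eq; ring

/-- sum of weights over nonzero multiples of `g` -/
lemma wt_sum (n g : ℕ) (hn : 0 < n) (hg : g ∣ n) :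
    ∑ h ∈ (range n).filter (fun h => h ≠ 0 ∧ g ∣ h), wt n h ≤ (1 + Real.log n) / g := by
  obtain ⟨k, rfl⟩ := hg
  have hg0 : 0 < g := Nat.pos_of_mul_pos_right hn
  have hk0 : 0 < k := Nat.pos_of_mul_pos_left hn
  have hgR : (0 : ℝ) < g := by exact_mod_cast hg0
  have h1 : ∑ h ∈ (range (g * k)).filter (fun h => h ≠ 0 ∧ g ∣ h), wt (g * k) h =
      ∑ u ∈ range (k - 1), (1 / g : ℝ) * ((1 / 2) * (1 / ((u : ℝ) + 1) + 1 / (((k - 1 - 1 - u : ℕ) : ℝ) + 1))) := by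
    symm
    refine Finset.sum_bij (fun u _ => g * (u + 1)) ?_ ?_ ?_ ?_
    · intro u hu
      simp only [Finset.mem_range, Finset.mem_filter] at hu ⊢
      refine ⟨Nat.mul_lt_mul_of_pos_left (by omega) hg0, ?_, dvd_mul_right _ _⟩
      positivity
    · intro a _ b _ h
      have := Nat.eq_of_mul_eq_mul_left hg0 h
      omega
    · intro b hb
      simp only [Finset.mem_range, Finset.mem_filter] at hb
      obtain ⟨hb1, hb2, c, rfl⟩ := hb
      have hc : c ≠ 0 := by rintro rfl; simp at hb2
      have hc2 : c < k := Nat.lt_of_mul_lt_mul_left hb1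
      exact ⟨c - 1, by rw [Finset.mem_range]; omega, by congr 1; omega⟩
    · intro u hu
      rw [Finset.mem_range] at hu
      unfold wt
      rw [if_neg (by positivity)]
      have e : ((k - 1 - 1 - u : ℕ) : ℝ) + 1 = k - (u + 1) := by
        have : k = (k - 1 - 1 - u) + 1 + (u + 1) := by omega
        have h2 : (k : ℝ) = ((k - 1 - 1 - u : ℕ) : ℝ) + 1 + (u + 1) := by exact_mod_cast this
        linarith
      rw [e]
      have hpos : (0 : ℝ) < k - (u + 1) := by rw [← e]; positivity
      push_cast
      rw [← mul_sub]
      field_simp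
  rw [h1, ← Finset.mul_sum, ← Finset.mul_sum, Finset.sum_add_distrib,
    Finset.sum_range_reflect (fun u : ℕ => 1 / ((u : ℝ) + 1))]
  have h2 : ∑ u ∈ range (k - 1), 1 / ((u : ℝ) + 1) = (harmonic (k - 1) : ℝ) := by
    unfold harmonic; push_cast; simp
  rw [h2]
  have h3 : (harmonic (k - 1) : ℝ) ≤ 1 + Real.log (g * k : ℕ) := by
    refine (harmonic_le_one_add_log _).trans ?_
    rcases Nat.eq_zero_or_pos (k - 1) with h | h
    · rw [h]; simp
      rw [← Nat.cast_mul]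
      exact Real.log_natCast_nonneg _
    · have : ((k - 1 : ℕ) : ℝ) ≤ (g * k : ℕ) := by
        exact_mod_cast (by nlinarith [Nat.sub_le k 1])
      have h' : (0 : ℝ) < (k - 1 : ℕ) := by exact_mod_cast h
      linarith [Real.log_le_log h' this]
  rw [one_div_mul_eq_div]
  apply div_le_div_of_nonneg_right _ hgR.le
  linarith

open Classical in
lemma count_sol (P α d q h k : ℕ) (hP : P.Prime) (hd : d = P ^ α) [NeZero d]
    (hq : Nat.gcd q P = 1) (hh : ¬ d ∣ h) :
    (((univ : Finset (ZMod d)).filter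
      (fun r => IsUnit r ∧ (h : ZMod d) * r + k * q = 0)).card : ℝ) ≤
      ∑ j ∈ range α, if P ^ j ∣ h ∧ P ^ j ∣ k then (P : ℝ) ^ j else 0 := by
  set s := (univ : Finset (ZMod d)).filter (fun r => IsUnit r ∧ (h : ZMod d) * r + k * q = 0) with hs
  have hnn : ∀ j ∈ range α, (0 : ℝ) ≤ if P ^ j ∣ h ∧ P ^ j ∣ k then (P : ℝ) ^ j else 0 := by
    intro j _; split_ifs <;> positivity
  rcases s.eq_empty_or_nonempty with he | ⟨r0, hr0⟩
  · rw [he]; simpa using Finset.sum_nonneg hnn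
  obtain ⟨j, hj, hg⟩ := (Nat.dvd_prime_pow hP).1
    (show Nat.gcd h d ∣ P ^ α by rw [← hd]; exact Nat.gcd_dvd_right h d)
  have hjα : j < α := by
    rcases lt_or_eq_of_le hj with h' | h'
    · exact h'
    · exfalso; apply hh
      rw [hd, ← h', ← hg]; exact Nat.gcd_dvd_left _ _
  have hdvdh : P ^ j ∣ h := by rw [← hg]; exact Nat.gcd_dvd_left _ _
  have hdvdd : P ^ j ∣ d := by rw [← hg]; exact Nat.gcd_dvd_right _ _
  have hPj : 0 < P ^ j := pow_pos hP.pos _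
  have hd0 : 0 < d := Nat.pos_of_ne_zero (NeZero.ne d)
  have hsol : ∀ r ∈ s, d ∣ h * r.val + k * q := by
    intro r hr
    rw [hs, Finset.mem_filter] at hr
    rw [← ZMod.natCast_eq_zero_iff]
    push_cast
    rw [ZMod.natCast_zmod_val]
    exact hr.2.2
  have hdvdk : P ^ j ∣ k := by
    have h1 := hdvdd.trans (hsol r0 hr0)
    have h2 : P ^ j ∣ k * q := (Nat.dvd_add_right (hdvdh.mul_right _)).1 h1
    refine Nat.Coprime.dvd_of_dvd_mul_right ?_ h2
    exact Nat.Coprime.pow_left _ (Nat.coprime_comm.1 hq)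
  refine le_trans ?_ (Finset.single_le_sum hnn (Finset.mem_range.2 hjα))
  rw [if_pos ⟨hdvdh, hdvdk⟩]
  obtain ⟨D, hD⟩ := hdvdd
  have hD0 : 0 < D := by
    rcases Nat.eq_zero_or_pos D with h' | h'
    · rw [h'] at hD; omega
    · exact h'
  have hcard : s.card ≤ (range (P ^ j)).card := by
    apply Finset.card_le_card_of_injOn (fun r => r.val / D)
    · intro r _
      simp only [Finset.coe_range, Set.mem_Iio]
      rw [Nat.div_lt_iff_lt_mul hD0, ← hD]
      exact ZMod.val_lt r
    · intro r hr r' hr' heq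
      have h1 := hsol r hr
      have h2 := hsol r' hr'
      have h3 : h * r.val ≡ h * r'.val [MOD d] := by
        have : h * r.val + k * q ≡ h * r'.val + k * q [MOD d] :=
          ((Nat.modEq_zero_iff_dvd).2 h1).trans ((Nat.modEq_zero_iff_dvd).2 h2).symm
        exact Nat.ModEq.add_right_cancel' _ this
      have h4 : r.val ≡ r'.val [MOD D] := by
        have := Nat.ModEq.cancel_left_div_gcd hd0 h3
        rw [Nat.gcd_comm, hg] at this
        have e : d / P ^ j = D := by rw [hD, Nat.mul_div_cancel_left _ hPj]
        rwa [e] at this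
      have h5 : r.val = r'.val := by
        have a1 := Nat.div_add_mod r.val D
        have a2 := Nat.div_add_mod r'.val D
        simp only at heq
        rw [← a1, ← a2, heq, h4]
      exact ZMod.val_injective d h5
  rw [Finset.card_range] at hcard
  exact_mod_cast hcard

open Classical in
noncomputable def Fs (n d q : ℕ) (r : ZMod d) : ℝ :=
  ∑ h ∈ range n, ∑ k ∈ range n,
    if ¬ d ∣ h ∧ ¬ d ∣ k ∧ (h : ZMod d) * r + k * q = 0 then wt n h * wt n k else 0

lemma Fs_nonneg (n d q : ℕ) (r : ZMod d) : 0 ≤ Fs n d q r := by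
  unfold Fs
  refine Finset.sum_nonneg fun h hh => Finset.sum_nonneg fun k hk => ?_
  rw [Finset.mem_range] at hh hk
  split_ifs
  · exact mul_nonneg (wt_nonneg _ _ hh) (wt_nonneg _ _ hk)
  · exact le_rfl

open Classical in
lemma Fs_sum (n P α d q : ℕ) (hn : 0 < n) (hP : P.Prime) (hd : d = P ^ α) [NeZero d] (hdn : d ∣ n)
    (hq : Nat.gcd q P = 1) :
    ∑ r ∈ (univ : Finset (ZMod d)).filter (fun r => IsUnit r), Fs n d q r ≤ 2 * (1 + Real.log n) ^ 2 := by
  set u : ℕ → ℕ → ℝ := fun j h => if h ≠ 0 ∧ P ^ j ∣ h then wt n h else 0 with hu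
  have hu0 : ∀ j, ∀ h ∈ range n, 0 ≤ u j h := by
    intro j h hh
    simp only [hu]
    split_ifs
    · exact wt_nonneg _ _ (Finset.mem_range.1 hh)
    · exact le_rfl
  have hPR : (2 : ℝ) ≤ P := by exact_mod_cast hP.two_le
  have hL : 0 ≤ 1 + Real.log n := by linarith [Real.log_natCast_nonneg n]
  have h1 : ∑ r ∈ (univ : Finset (ZMod d)).filter (fun r => IsUnit r), Fs n d q r ≤
      ∑ h ∈ range n, ∑ k ∈ range n, ∑ j ∈ range α, (P : ℝ) ^ j * (u j h * u j k) := by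
    unfold Fs
    rw [Finset.sum_comm]
    refine Finset.sum_le_sum fun h hh => ?_
    rw [Finset.sum_comm]
    refine Finset.sum_le_sum fun k hk => ?_
    have w1 := wt_nonneg n h (Finset.mem_range.1 hh)
    have w2 := wt_nonneg n k (Finset.mem_range.1 hk)
    by_cases hc : ¬ d ∣ h ∧ ¬ d ∣ k
    · have hh0 : h ≠ 0 := by rintro rfl; simp at hc
      have hk0 : k ≠ 0 := by rintro rfl; simp at hc
      have := count_sol P α d q h k hP hd hq hc.1
      have e : ∑ r ∈ (univ : Finset (ZMod d)).filter (fun r => IsUnit r),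
          (if ¬ d ∣ h ∧ ¬ d ∣ k ∧ (h : ZMod d) * r + k * q = 0 then wt n h * wt n k else 0) =
          (((univ : Finset (ZMod d)).filter
            (fun r => IsUnit r ∧ (h : ZMod d) * r + k * q = 0)).card : ℝ) * (wt n h * wt n k) := by
        simp only [hc.1, hc.2, not_false_eq_true, true_and]
        rw [← Finset.sum_filter, Finset.filter_filter, Finset.sum_const, nsmul_eq_mul]
      rw [e]
      refine (mul_le_mul_of_nonneg_right this (mul_nonneg w1 w2)).trans (le_of_eq ?_)
      rw [Finset.sum_mul]
      refine Finset.sum_congr rfl fun j _ => ?_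
      simp only [hu, ne_eq, hh0, hk0, not_false_eq_true, true_and]
      by_cases c1 : P ^ j ∣ h <;> by_cases c2 : P ^ j ∣ k <;> simp [c1, c2]
    · have e : ∀ r ∈ (univ : Finset (ZMod d)).filter (fun r => IsUnit r),
          (if ¬ d ∣ h ∧ ¬ d ∣ k ∧ (h : ZMod d) * r + k * q = 0 then wt n h * wt n k else 0) = 0 := by
        intro r _
        rw [if_neg]
        tauto
      rw [Finset.sum_congr rfl e, Finset.sum_const_zero]
      refine Finset.sum_nonneg fun j _ => ?_
      exact mul_nonneg (by positivity) (mul_nonneg (hu0 j h hh) (hu0 j k hk))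
  have h2 : ∑ h ∈ range n, ∑ k ∈ range n, ∑ j ∈ range α, (P : ℝ) ^ j * (u j h * u j k) =
      ∑ j ∈ range α, (P : ℝ) ^ j * (∑ h ∈ range n, u j h) ^ 2 := by
    have : ∀ h ∈ range n, ∑ k ∈ range n, ∑ j ∈ range α, (P : ℝ) ^ j * (u j h * u j k) =
        ∑ j ∈ range α, ∑ k ∈ range n, (P : ℝ) ^ j * (u j h * u j k) := fun h _ => Finset.sum_comm
    rw [Finset.sum_congr rfl this, Finset.sum_comm]
    refine Finset.sum_congr rfl fun j _ => ?_
    rw [sq, Finset.sum_mul_sum, Finset.mul_sum]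
    refine Finset.sum_congr rfl fun h _ => ?_
    rw [Finset.mul_sum]
  rw [h2] at h1
  refine h1.trans ?_
  have h3 : ∀ j ∈ range α, (P : ℝ) ^ j * (∑ h ∈ range n, u j h) ^ 2 ≤
      (1 + Real.log n) ^ 2 * (1 / 2) ^ j := by
    intro j hj
    have hdj : P ^ j ∣ n := by
      refine dvd_trans ?_ hdn
      rw [hd]; exact pow_dvd_pow _ (Finset.mem_range.1 hj).le
    have hs : ∑ h ∈ range n, u j h ≤ (1 + Real.log n) / ((P ^ j : ℕ) : ℝ) := by
      have := wt_sum n (P ^ j) hn hdj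
      rwa [Finset.sum_filter] at this
    push_cast at hs
    have hpp : (0 : ℝ) < (P : ℝ) ^ j := by positivity
    have hs0 : 0 ≤ ∑ h ∈ range n, u j h := Finset.sum_nonneg (hu0 j)
    calc (P : ℝ) ^ j * (∑ h ∈ range n, u j h) ^ 2 ≤ (P : ℝ) ^ j * ((1 + Real.log n) / (P : ℝ) ^ j) ^ 2 := by
          gcongr
      _ = (1 + Real.log n) ^ 2 * (1 / (P : ℝ)) ^ j := by
          rw [one_div, inv_pow]; field_simp
      _ ≤ _ := by
          gcongr
  refine (Finset.sum_le_sum h3).trans ?_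
  rw [← Finset.mul_sum]
  have : ∑ j ∈ range α, (1 / 2 : ℝ) ^ j ≤ 2 := sum_geometric_two_le α
  nlinarith [sq_nonneg (1 + Real.log n)]

lemma wt_sum' (n g : ℕ) (hn : 0 < n) (hg : g ∣ n) :
    ∑ h ∈ range n, (if g ∣ h then wt n h else 0) ≤ 1 + (1 + Real.log n) / g := by
  have h1 : ∀ h ∈ range n, (if g ∣ h then wt n h else 0) =
      (if h = 0 then (1 : ℝ) else 0) + (if h ≠ 0 ∧ g ∣ h then wt n h else 0) := by
    intro h _
    by_cases h0 : h = 0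
    · subst h0; simp [wt]
    · simp [h0]
  rw [Finset.sum_congr rfl h1, Finset.sum_add_distrib, ← Finset.sum_filter (fun h => h ≠ 0 ∧ g ∣ h)]
  refine add_le_add (le_of_eq ?_) (wt_sum n g hn hg)
  rw [Finset.sum_ite_eq', if_pos (Finset.mem_range.2 hn)]

lemma E_expand (n : ℕ) [NeZero n] (p q : ℕ) (hp : 2 * p - 1 ≤ n - 1) (hq : 2 * q - 1 ≤ n - 1) :
    |Efun n p q| ≤ ∑ h ∈ range n, ∑ k ∈ range n,
      if h = 0 ∧ k = 0 then 0 else wt n h * wt n k * ‖Gs n ((h * p + k * q : ℕ) : ZMod n)‖ := by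
  have hn : 0 < n := Nat.pos_of_ne_zero (NeZero.ne n)
  set main : ℂ := ((2 * p - 1 : ℕ) : ℂ) * ((2 * q - 1 : ℕ) : ℂ) * (Nat.totient n : ℂ) / (n : ℂ) ^ 2
    with hmain
  have hE : ((Efun n p q : ℝ) : ℂ) = ∑ h ∈ range n, ∑ k ∈ range n,
      (cf n (2 * p - 1) h * cf n (2 * q - 1) k * Gs n ((h * p + k * q : ℕ) : ZMod n)
        - if h = 0 ∧ k = 0 then main else 0) := by
    simp_rw [Finset.sum_sub_distrib]
    rw [← S_expand n p q hp hq]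
    have : ∑ h ∈ range n, ∑ k ∈ range n, (if h = 0 ∧ k = 0 then main else 0) = main := by
      simp_rw [ite_and]
      rw [Finset.sum_eq_single 0]
      · simp [hn.ne']
      · intro b _ hb; simp [hb]
      · intro h; simp at h; omega
    rw [this, hmain]
    unfold Efun
    push_cast
    ring
  rw [← Real.norm_eq_abs, ← Complex.norm_real, hE]
  refine (norm_sum_le _ _).trans (Finset.sum_le_sum fun h hh => ?_)
  refine (norm_sum_le _ _).trans (Finset.sum_le_sum fun k hk => ?_)
  rw [Finset.mem_range] at hh hk
  split_ifs with hc
  · obtain ⟨rfl, rfl⟩ := hc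
    apply le_of_eq
    rw [norm_eq_zero, sub_eq_zero, hmain]
    have : (n : ℂ) ≠ 0 := by exact_mod_cast hn.ne'
    simp [cf, Gs, Un_card]
    field_simp
  · rw [sub_zero, norm_mul, norm_mul]
    gcongr
    · exact wt_nonneg _ _ hh
    · exact cf_norm n _ h hp hh
    · exact cf_norm n _ k hq hk

lemma E_trivial (n : ℕ) (hn : 2 ≤ n) (p q : ℕ) (hp : 2 * p - 1 ≤ n - 1) (hq : 2 * q - 1 ≤ n - 1) :
    |Efun n p q| ≤ n.totient := by
  have hS : Sfun n p q ≤ n.totient := by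
    rw [← Un_card, Finset.card_eq_sum_ones]
    unfold Sfun
    refine Finset.sum_le_sum fun a _ => ?_
    unfold ind
    split_ifs <;> simp
  have hSR : (Sfun n p q : ℝ) ≤ n.totient := by exact_mod_cast hS
  have hS0 : (0 : ℝ) ≤ Sfun n p q := by positivity
  have hp' : ((2 * p - 1 : ℕ) : ℝ) ≤ n := by exact_mod_cast (by omega)
  have hq' : ((2 * q - 1 : ℕ) : ℝ) ≤ n := by exact_mod_cast (by omega)
  have hn0 : (0 : ℝ) < n := by exact_mod_cast (by omega)
  have hM : ((2 * p - 1 : ℕ) : ℝ) * ((2 * q - 1 : ℕ) : ℝ) * (Nat.totient n : ℝ) / (n : ℝ) ^ 2 ≤ n.totient := by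
    rw [div_le_iff₀ (by positivity), mul_comm (n.totient : ℝ), sq]
    gcongr
  have hM0 : 0 ≤ ((2 * p - 1 : ℕ) : ℝ) * ((2 * q - 1 : ℕ) : ℝ) * (Nat.totient n : ℝ) / (n : ℝ) ^ 2 := by
    positivity
  unfold Efun
  rw [abs_le]
  constructor <;> linarith

lemma E_bound (n : ℕ) (hn : 2 ≤ n) (P α m d q p : ℕ) (hP : P.Prime) (hα1 : 1 ≤ α)
    (hnm : n = P ^ α * m) (hPm : Nat.gcd P m = 1) (hd : d = P ^ α)
    (hq2 : 2 * q - 1 ≤ n - 1) (hqP : Nat.gcd q P = 1)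
    (hp2 : 2 * p - 1 ≤ n - 1) (hpP : Nat.gcd p P = 1) :
    |Efun n p q| ≤ n.totient * ((2 + Real.log n) ^ 2 / ((P : ℝ) - 1) +
      ((1 + (1 + Real.log n) / d) ^ 2 - 1) + Fs n d q (p : ZMod d)) := by
  classical
  haveI : NeZero n := ⟨by omega⟩
  have hP1 : (0 : ℝ) < (P : ℝ) - 1 := by
    have : (1 : ℝ) < P := by exact_mod_cast hP.one_lt
    linarith
  have hdn : d ∣ n := ⟨m, by rw [hd, hnm]⟩
  have hL : 0 ≤ Real.log n := Real.log_natCast_nonneg n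
  refine (E_expand n p q hp2 hq2).trans ?_
  set v : ℕ → ℝ := fun h => if d ∣ h then wt n h else 0 with hv
  set z : ℕ → ℝ := fun h => if h = 0 then 1 else 0 with hz
  set f : ℕ → ℕ → ℝ := fun h k =>
    if ¬ d ∣ h ∧ ¬ d ∣ k ∧ (h : ZMod d) * (p : ZMod d) + k * q = 0 then wt n h * wt n k else 0 with hf
  have hz0 : ∀ h, 0 ≤ z h := by intro h; simp only [hz]; split_ifs <;> norm_num
  have hzv : ∀ h ∈ range n, z h ≤ v h := by
    intro h hh
    have := wt_nonneg n h (Finset.mem_range.1 hh)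
    simp only [hz, hv]
    by_cases h0 : h = 0
    · subst h0; simp [wt]
    · rw [if_neg h0]; split_ifs <;> linarith
  have hterm : ∀ h ∈ range n, ∀ k ∈ range n,
      (if h = 0 ∧ k = 0 then 0 else wt n h * wt n k * ‖Gs n ((h * p + k * q : ℕ) : ZMod n)‖) ≤
      n.totient * (wt n h * wt n k / ((P : ℝ) - 1) + (v h * v k - z h * z k) + f h k) := by
    intro h hh k hk
    have w1 := wt_nonneg n h (Finset.mem_range.1 hh)
    have w2 := wt_nonneg n k (Finset.mem_range.1 hk)
    have w12 := mul_nonneg w1 w2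
    have hA0 : 0 ≤ wt n h * wt n k / ((P : ℝ) - 1) := by positivity
    have hB0 : 0 ≤ v h * v k - z h * z k := by
      have := mul_le_mul (hzv h hh) (hzv k hk) (hz0 k) ((hz0 h).trans (hzv h hh))
      linarith
    have hC0 : 0 ≤ f h k := by simp only [hf]; split_ifs <;> [exact w12; exact le_rfl]
    have hφ : (0 : ℝ) ≤ n.totient := by positivity
    split_ifs with hc
    · exact mul_nonneg hφ (by linarith)
    · by_cases ht : d ∣ h * p + k * q
      · have hG := Gs_le n ((h * p + k * q : ℕ) : ZMod n)
        have hle : wt n h * wt n k ≤ wt n h * wt n k / ((P : ℝ) - 1) + (v h * v k - z h * z k) + f h k := by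
          by_cases hdh : d ∣ h
          · have hdk : d ∣ k := by
              have h2 : d ∣ k * q := (Nat.dvd_add_right (hdh.mul_right _)).1 ht
              refine Nat.Coprime.dvd_of_dvd_mul_right ?_ h2
              rw [hd]; exact Nat.Coprime.pow_left _ (Nat.coprime_comm.1 hqP)
            have hzz : z h * z k = 0 := by
              simp only [hz]
              by_cases a : h = 0 <;> by_cases b : k = 0 <;> simp [a, b] <;> tauto
            have hvv : v h * v k = wt n h * wt n k := by simp [hv, hdh, hdk]
            linarith
          · have hdk : ¬ d ∣ k := by
              intro hdk
              have h2 : d ∣ h * p := (Nat.dvd_add_left (hdk.mul_right _)).1 ht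
              apply hdh
              refine Nat.Coprime.dvd_of_dvd_mul_right ?_ h2
              rw [hd]; exact Nat.Coprime.pow_left _ (Nat.coprime_comm.1 hpP)
            have hff : f h k = wt n h * wt n k := by
              simp only [hf]
              rw [if_pos]
              refine ⟨hdh, hdk, ?_⟩
              have := (ZMod.natCast_eq_zero_iff (h * p + k * q) d).2 ht
              push_cast at this
              exact this
            linarith
        calc wt n h * wt n k * ‖Gs n ((h * p + k * q : ℕ) : ZMod n)‖
            ≤ wt n h * wt n k * n.totient := by gcongr
          _ = n.totient * (wt n h * wt n k) := by ring
          _ ≤ _ := by gcongr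
      · have hG := Gs_le' n P α m hP hα1 hnm hPm (h * p + k * q) (by rwa [← hd])
        calc wt n h * wt n k * ‖Gs n ((h * p + k * q : ℕ) : ZMod n)‖
            ≤ wt n h * wt n k * (n.totient / ((P : ℝ) - 1)) := by gcongr
          _ = n.totient * (wt n h * wt n k / ((P : ℝ) - 1)) := by ring
          _ ≤ _ := by apply mul_le_mul_of_nonneg_left _ hφ; linarith
  refine (Finset.sum_le_sum fun h hh => Finset.sum_le_sum fun k hk => hterm h hh k hk).trans ?_
  have hsum : ∑ h ∈ range n, ∑ k ∈ range n,
      (n.totient : ℝ) * (wt n h * wt n k / ((P : ℝ) - 1) + (v h * v k - z h * z k) + f h k) =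
      n.totient * ((∑ h ∈ range n, wt n h) ^ 2 / ((P : ℝ) - 1) +
        ((∑ h ∈ range n, v h) ^ 2 - (∑ h ∈ range n, z h) ^ 2) + Fs n d q (p : ZMod d)) := by
    simp_rw [← Finset.mul_sum, Finset.sum_add_distrib, Finset.sum_sub_distrib, ← Finset.sum_div, sq,
      Finset.sum_mul_sum]
    rfl
  rw [hsum]
  have s1 : ∑ h ∈ range n, wt n h ≤ 2 + Real.log n := by
    have := wt_sum' n 1 (by omega) (one_dvd _)
    simp at this
    linarith
  have s2 : ∑ h ∈ range n, v h ≤ 1 + (1 + Real.log n) / d := wt_sum' n d (by omega) hdn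
  have s3 : ∑ h ∈ range n, z h = 1 := by
    simp only [hz]
    rw [Finset.sum_ite_eq', if_pos (Finset.mem_range.2 (by omega))]
  have s1' : 0 ≤ ∑ h ∈ range n, wt n h :=
    Finset.sum_nonneg fun h hh => wt_nonneg n h (Finset.mem_range.1 hh)
  have s2' : 0 ≤ ∑ h ∈ range n, v h :=
    Finset.sum_nonneg fun h hh => (hz0 h).trans (hzv h hh)
  rw [s3, one_pow]
  gcongr

set_option maxHeartbeats 1000000

/-- Error bound with a large prime factor: with `P = P⁺(n)`, `n = P^α m`, `d = P^α`,
`gcd(q,P) = 1`, and `R ≥ 2`, there is a set `B ⊆ (ℤ/dℤ)ˣ` of size `≤ φ(d)/R` such that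
whenever `gcd(p,P) = 1` and `p mod d ∉ B`, one has
`|E(p,q)| ≤ 9 R φ(n)(1+log n)²/P`. -/
theorem stmt2 (n : ℕ) (hn : 2 ≤ n) (P : ℕ) (hP : P = Pplus n)
    (α : ℕ) (hα : α = n.factorization P) (hα1 : 1 ≤ α)
    (m : ℕ) (hnm : n = P ^ α * m) (hPm : Nat.gcd P m = 1)
    (d : ℕ) (hd : d = P ^ α)
    (q : ℕ) (hq1 : 1 ≤ 2 * q - 1) (hq2 : 2 * q - 1 ≤ n - 1) (hqP : Nat.gcd q P = 1)
    (R : ℝ) (hR : 2 ≤ R) :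
    ∃ B : Finset (ZMod d), (∀ b ∈ B, IsUnit b) ∧ (B.card : ℝ) ≤ (Nat.totient d : ℝ) / R ∧
      ∀ p : ℕ, 1 ≤ 2 * p - 1 → 2 * p - 1 ≤ n - 1 → Nat.gcd p P = 1 →
        (p : ZMod d) ∉ B →
        |Efun n p q| ≤ 9 * R * (Nat.totient n : ℝ) * (1 + Real.log n) ^ 2 / (P : ℝ) := by

  classical
  set L := 1 + Real.log n with hLdef
  have hL1 : 1 ≤ L := by
    have := Real.log_natCast_nonneg n
    linarith
  have hPp : P.Prime := by
    by_contra h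
    rw [Nat.factorization_eq_zero_of_not_prime n h] at hα
    omega
  have hP0 : (0 : ℝ) < P := by exact_mod_cast hPp.pos
  have hφ0 : (0 : ℝ) ≤ n.totient := by positivity
  rcases le_or_gt (P : ℝ) (9 * R * L ^ 2) with hcase | hcase
  · refine ⟨∅, by simp, ?_, ?_⟩
    · simp only [Finset.card_empty, Nat.cast_zero]
      positivity
    · intro p _ hp2 _ _
      refine (E_trivial n hn p q hp2 hq2).trans ?_
      rw [le_div_iff₀ hP0]
      nlinarith [mul_le_mul_of_nonneg_left hcase hφ0]
  · haveI : NeZero d := ⟨by rw [hd]; exact (pow_pos hPp.pos _).ne'⟩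
    have hL2 : 1 ≤ L ^ 2 := one_le_pow₀ hL1
    have hP18 : (18 : ℝ) < P := by nlinarith
    have hPd : (P : ℝ) ≤ d := by
      rw [hd]
      exact_mod_cast Nat.le_self_pow (by omega) P
    have hφd : (P : ℝ) - 1 ≤ d.totient := by
      rw [hd, Nat.totient_prime_pow hPp hα1]
      push_cast [Nat.cast_sub hPp.one_le]
      have : (1 : ℝ) ≤ (P : ℝ) ^ (α - 1) := one_le_pow₀ (by linarith)
      nlinarith
    have hφd0 : (0 : ℝ) < d.totient := by linarith
    set T := 2 * R * L ^ 2 / d.totient with hT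
    have hT0 : 0 < T := by positivity
    set U := (univ : Finset (ZMod d)).filter (fun r => IsUnit r) with hU
    have hsumF := Fs_sum n P α d q (by omega) hPp hd ⟨m, by rw [hd, hnm]⟩ hqP
    rw [← hLdef, ← hU] at hsumF
    refine ⟨U.filter (fun r => T < Fs n d q r), ?_, ?_, ?_⟩
    · intro b hb
      rw [Finset.mem_filter, hU, Finset.mem_filter] at hb
      exact hb.1.2
    · set B := U.filter (fun r => T < Fs n d q r) with hB
      have h1 : (B.card : ℝ) * T ≤ ∑ r ∈ U, Fs n d q r := by
        rw [← nsmul_eq_mul]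
        refine (Finset.card_nsmul_le_sum B (fun r => Fs n d q r) T ?_).trans ?_
        · intro r hr
          exact (Finset.mem_filter.1 hr).2.le
        · exact Finset.sum_le_sum_of_subset_of_nonneg (Finset.filter_subset _ _)
            (fun r _ _ => Fs_nonneg _ _ _ _)
      have h2 : (B.card : ℝ) * T ≤ 2 * L ^ 2 := h1.trans hsumF
      rw [hT, mul_div_assoc', div_le_iff₀ hφd0] at h2
      rw [le_div_iff₀ (by linarith)]
      have : 0 < 2 * L ^ 2 := by positivity
      refine le_of_mul_le_mul_left ?_ this
      linarith
    · intro p _ hp2 hpP hpB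
      have hunit : IsUnit (p : ZMod d) := by
        rw [ZMod.isUnit_iff_coprime, hd]
        exact Nat.Coprime.pow_right _ hpP
      have hF : Fs n d q (p : ZMod d) ≤ T := by
        by_contra hc
        push Not at hc
        exact hpB (Finset.mem_filter.2 ⟨Finset.mem_filter.2 ⟨Finset.mem_univ _, hunit⟩, hc⟩)
      refine (E_bound n hn P α m d q p hPp hα1 hnm hPm hd hq2 hqP hp2 hpP).trans ?_
      have e : 2 + Real.log n = 1 + L := by rw [hLdef]; ring
      rw [e, ← hLdef]
      have hinv : 1 / ((P : ℝ) - 1) ≤ (3 / 2) / P := by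
        rw [div_le_div_iff₀ (by linarith) hP0]; linarith
      have t1 : (1 + L) ^ 2 / ((P : ℝ) - 1) ≤ 6 * L ^ 2 / P := by
        have : (1 + L) ^ 2 ≤ 4 * L ^ 2 := by nlinarith
        calc (1 + L) ^ 2 / ((P : ℝ) - 1) = (1 + L) ^ 2 * (1 / ((P : ℝ) - 1)) := by ring
          _ ≤ (4 * L ^ 2) * ((3 / 2) / P) := by
            apply mul_le_mul this hinv _ (by positivity)
            apply one_div_nonneg.2; linarith
          _ = _ := by ring
      have t2 : (1 + L / d) ^ 2 - 1 ≤ 3 * L ^ 2 / P := by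
        have a1 : L / d ≤ L / P := by gcongr
        have a2 : L / P ≤ 1 := by
          rw [div_le_one hP0]; nlinarith
        have a3 : 0 ≤ L / d := by positivity
        have a4 : L / P ≤ L ^ 2 / P := by
          gcongr; nlinarith
        have a5 : 3 * L ^ 2 / P = 3 * (L ^ 2 / P) := by ring
        nlinarith
      have hRL : 0 ≤ 2 * R * L ^ 2 := by positivity
      have t3 : T ≤ 3 * R * L ^ 2 / P := by
        calc T = 2 * R * L ^ 2 * (1 / d.totient) := by rw [hT]; ring
          _ ≤ 2 * R * L ^ 2 * (1 / ((P : ℝ) - 1)) := by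
            exact mul_le_mul_of_nonneg_left (one_div_le_one_div_of_le (by linarith) hφd) hRL
          _ ≤ 2 * R * L ^ 2 * ((3 / 2) / P) := mul_le_mul_of_nonneg_left hinv hRL
          _ = _ := by ring
      have t4 : 6 * L ^ 2 / P + 3 * L ^ 2 / P + 3 * R * L ^ 2 / P ≤ 9 * R * L ^ 2 / P := by
        rw [← add_div, ← add_div]
        gcongr
        nlinarith
      calc (n.totient : ℝ) * ((1 + L) ^ 2 / ((P : ℝ) - 1) + ((1 + L / d) ^ 2 - 1) + Fs n d q (p : ZMod d))
          ≤ n.totient * (9 * R * L ^ 2 / P) := by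
            apply mul_le_mul_of_nonneg_left _ hφ0
            linarith
        _ = _ := by ring
end

section
/- Let n ≥ 2, let P be a prime divisor of n, write n = P^α m with α = v_P(n) ≥ 1 and gcd(P, m) = 1, and set d = P^α. Let k be an integer with 1 ≤ k ≤ n−1 and d ∤ k. Then (1/φ(d)) Σ_{u ∈ (ℤ/dℤ)^×} 1/min([uk]_d, d − [uk]_d) ≤ 4(1 + log n)/d. -/
open Finset

lemma aux_periodic (F : ℕ → ℝ) (e g : ℕ) :
    ∑ u ∈ range (e * g), F (u % e) = g * ∑ r ∈ range e, F r := by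
  induction g with
  | zero => simp
  | succ g ih =>
    rw [Nat.mul_succ, sum_range_add, ih]
    have : ∑ x ∈ range e, F ((e * g + x) % e) = ∑ r ∈ range e, F r := by
      refine sum_congr rfl fun x hx => ?_
      rw [Nat.mul_add_mod, Nat.mod_eq_of_lt (mem_range.1 hx)]
    rw [this]; push_cast; ring

lemma aux_perm (F : ℕ → ℝ) (e k : ℕ) (he : 0 < e) (h : Nat.Coprime e k) :
    ∑ r ∈ range e, F ((r * k) % e) = ∑ r ∈ range e, F r := by
  have hinj : Set.InjOn (fun r => (r * k) % e) (range e : Set ℕ) := by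
    intro a ha b hb hab
    have h1 : a * k ≡ b * k [MOD e] := hab
    have h2 : a ≡ b [MOD e] := Nat.ModEq.cancel_right_of_coprime h h1
    exact Nat.ModEq.eq_of_lt_of_lt h2 (by simpa using ha) (by simpa using hb)
  have him : (range e).image (fun r => (r * k) % e) = range e := by
    apply eq_of_subset_of_card_le
    · intro x hx
      obtain ⟨y, -, rfl⟩ := mem_image.1 hx
      exact mem_range.2 (Nat.mod_lt _ he)
    · rw [card_image_of_injOn hinj]
  conv_rhs => rw [← him]
  rw [sum_image hinj]

lemma aux_harm (e g : ℕ) (he : 0 < e) (hg : 0 < g) :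
    (g : ℝ) * ∑ r ∈ range e, (1 : ℝ) / ((min (g * r) (g * e - g * r) : ℕ) : ℝ)
      ≤ 2 * (1 + Real.log (e - 1 : ℕ)) := by
  obtain ⟨D, rfl⟩ : ∃ D, e = D + 1 := ⟨e - 1, by omega⟩
  have hH : ∑ i ∈ range D, (1 : ℝ) / ((i : ℝ) + 1) ≤ 1 + Real.log D := by
    have := harmonic_le_one_add_log D
    simpa [harmonic] using this
  have hH' : ∑ i ∈ range D, (1 : ℝ) / ((D : ℝ) - i) ≤ 1 + Real.log D := by
    rw [← sum_range_reflect] at hH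
    refine le_of_eq_of_le (sum_congr rfl fun i hi => ?_) hH
    have := mem_range.1 hi
    rw [Nat.cast_sub (by omega), Nat.cast_sub (by omega)]
    congr 1
    push_cast; ring
  rw [sum_range_succ', mul_add, mul_sum]
  have : ∑ i ∈ range D, (g : ℝ) * ((1 : ℝ) / ((min (g * (i + 1)) (g * (D + 1) - g * (i + 1)) : ℕ) : ℝ))
      ≤ ∑ i ∈ range D, ((1 : ℝ) / ((i : ℝ) + 1) + (1 : ℝ) / ((D : ℝ) - i)) := by
    refine sum_le_sum fun i hi => ?_
    have hi := mem_range.1 hi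
    have hi' : (0 : ℝ) < (D : ℝ) - i := sub_pos.2 (by exact_mod_cast hi)
    have hg' : (0 : ℝ) < g := by exact_mod_cast hg
    have hp : (0 : ℝ) < (i : ℝ) + 1 := by positivity
    have e1 : g * (D + 1) - g * (i + 1) = g * (D - i) := by
      rw [← Nat.mul_sub]; congr 1; omega
    rw [e1]
    rcases min_choice (g * (i + 1)) (g * (D - i)) with h | h <;> rw [h]
    · have : (g : ℝ) * (1 / ((g * (i + 1) : ℕ) : ℝ)) = 1 / ((i : ℝ) + 1) := by
        push_cast; field_simp
      rw [this]
      have : 0 ≤ 1 / ((D : ℝ) - i) := by positivity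
      linarith
    · have : (g : ℝ) * (1 / ((g * (D - i) : ℕ) : ℝ)) = 1 / ((D : ℝ) - i) := by
        rw [Nat.cast_mul, Nat.cast_sub hi.le]; field_simp
      rw [this]
      have : 0 ≤ 1 / ((i : ℝ) + 1) := by positivity
      linarith
  rw [sum_add_distrib] at this
  simp only [mul_zero, Nat.zero_min, Nat.cast_zero, div_zero, add_zero, zero_le, inf_of_le_left, add_tsub_cancel_right]
  linarith

lemma aux_main (d k : ℕ) (hd : 0 < d) (n : ℕ) (hn : 1 ≤ n) (hdn : d ≤ n) :
    ∑ u ∈ range d, (1 : ℝ) / ((min ((u * k) % d) (d - (u * k) % d) : ℕ) : ℝ)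
      ≤ 2 * (1 + Real.log n) := by
  obtain ⟨g, e, k', hg, hc, rfl, rfl⟩ :
      ∃ g e k', 0 < g ∧ Nat.Coprime e k' ∧ d = e * g ∧ k = k' * g := by
    obtain ⟨e, k', hc, h1, h2⟩ := Nat.exists_coprime d k
    exact ⟨_, e, k', Nat.gcd_pos_of_pos_left _ hd, hc, h1, h2⟩
  have he : 0 < e := Nat.pos_of_mul_pos_right hd
  let G : ℕ → ℝ := fun r => (1 : ℝ) / ((min (g * r) (g * e - g * r) : ℕ) : ℝ)
  have h1 : ∑ u ∈ range (e * g), (1 : ℝ) /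
      ((min ((u * (k' * g)) % (e * g)) (e * g - (u * (k' * g)) % (e * g)) : ℕ) : ℝ)
      = ∑ u ∈ range (e * g), (fun r => G ((r * k') % e)) (u % e) := by
    refine sum_congr rfl fun u _ => ?_
    have : (u * (k' * g)) % (e * g) = g * ((u % e * k') % e) := by
      rw [← mul_assoc, Nat.mul_mod_mul_right, Nat.mod_mul_mod, mul_comm]
    simp only [G]
    rw [this, mul_comm e g]
  rw [h1, aux_periodic (fun r => G ((r * k') % e)) e g, aux_perm G e k' he hc]
  refine (aux_harm e g he hg).trans ?_
  have : Real.log (e - 1 : ℕ) ≤ Real.log n := by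
    rcases Nat.eq_zero_or_pos (e - 1) with h | h
    · rw [h]; simpa using Real.log_natCast_nonneg n
    · apply Real.log_le_log (by exact_mod_cast h)
      have : e ≤ e * g := Nat.le_mul_of_pos_right _ hg
      exact_mod_cast (by omega : e - 1 ≤ n)
  linarith

/-- Averaged reciprocal distance to `0` of `uk mod d`, over units `u ∈ (ℤ/dℤ)ˣ`
(represented by their least nonnegative residues): if `n ≥ 2`, `P` is a prime divisor
of `n`, `n = P^α m` with `α = v_P(n) ≥ 1` and `gcd(P,m) = 1`, `d = P^α`, and
`1 ≤ k ≤ n−1` with `d ∤ k`, then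
`(1/φ(d)) Σ_{u ∈ (ℤ/dℤ)ˣ} 1/min([uk]_d, d − [uk]_d) ≤ 4(1 + log n)/d`. -/
theorem stmt12 (n : ℕ) (hn : 2 ≤ n) (P : ℕ) (hP : P.Prime) (hPn : P ∣ n)
    (α : ℕ) (hα : α = n.factorization P) (hα1 : 1 ≤ α)
    (m : ℕ) (hnm : n = P ^ α * m) (hPm : Nat.gcd P m = 1)
    (d : ℕ) (hd : d = P ^ α)
    (k : ℕ) (hk1 : 1 ≤ k) (hk2 : k ≤ n - 1) (hdk : ¬ d ∣ k) :
    (1 / (Nat.totient d : ℝ)) *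
        ∑ u ∈ (Finset.range d).filter (fun u => Nat.gcd u d = 1),
          (1 : ℝ) / ((min ((u * k) % d) (d - (u * k) % d) : ℕ) : ℝ)
      ≤ 4 * (1 + Real.log n) / (d : ℝ) := by
  have hd0 : 0 < d := hd ▸ pow_pos hP.pos _
  have hdn : d ≤ n := Nat.le_of_dvd (by omega) ⟨m, by rw [hd]; exact hnm⟩
  have hS := aux_main d k hd0 n (by omega) hdn
  have hsub : ∑ u ∈ (Finset.range d).filter (fun u => Nat.gcd u d = 1),
          (1 : ℝ) / ((min ((u * k) % d) (d - (u * k) % d) : ℕ) : ℝ) ≤ 2 * (1 + Real.log n) :=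
    (sum_le_sum_of_subset_of_nonneg (filter_subset _ _) fun _ _ _ => by positivity).trans hS
  have hφ : d ≤ 2 * Nat.totient d := by
    rw [hd, Nat.totient_prime_pow hP (by omega)]
    obtain ⟨a, rfl⟩ : ∃ a, α = a + 1 := ⟨α - 1, by omega⟩
    have h2 : P ≤ 2 * (P - 1) := by have := hP.two_le; omega
    calc P ^ (a + 1) = P ^ a * P := pow_succ _ _
      _ ≤ P ^ a * (2 * (P - 1)) := Nat.mul_le_mul_left _ h2
      _ = _ := by rw [Nat.add_sub_cancel]; ring
  have hφ' : (d : ℝ) ≤ 2 * (Nat.totient d : ℝ) := by exact_mod_cast hφ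
  have hdr : (0 : ℝ) < d := by exact_mod_cast hd0
  have hinv : 1 / (Nat.totient d : ℝ) ≤ 2 / d := by
    rw [div_le_div_iff₀ (by linarith) hdr]; linarith
  have hl : 0 ≤ Real.log n := Real.log_natCast_nonneg n
  calc _ ≤ 2 / (d : ℝ) * (2 * (1 + Real.log n)) :=
        mul_le_mul hinv hsub (sum_nonneg fun _ _ => by positivity) (by positivity)
    _ = _ := by ring
end
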